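/- arXiv:1307.0767 — 4 statements merged into one kernel-verified Lean document; each statement's English description precedes it below -/
import Mathlib

section
/- Let A ⊆ ℕ have positive upper Banach density, i.e. BD(A) > 0. Then there exist infinite sets B, C ⊆ ℕ and a natural number k such that B + C ⊆ A ∪ (A + k), where B + C = {b + c : b ∈ B, c ∈ C} and A + k = {a + k : a ∈ A}. -/
/-- The (upper) Banach density of a set `A ⊆ ℕ`:
`BD(A) = lim_{n→∞} sup_{m∈ℕ} |A ∩ [m, m+n]| / n`. -/
noncomputable def banachDensity (A : Set ℕ) : ℝ :=
  Filter.atTop.limsup fun n : ℕ =>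
    ⨆ m : ℕ, (Nat.card ↥(A ∩ Set.Icc m (m + n)) : ℝ) / n

open Filter Classical in
lemma large_pair (U : Ultrafilter ℕ) (I : ℕ → Finset ℕ) (hI : ∀ m, (I m).Nonempty)
    (E : ℕ → Set ℕ) (S : Set ℕ) (hS : S.Infinite) (a : ℝ) (ha : 0 < a)
    (h : ∀ n ∈ S, ∀ᶠ m in (U : Filter ℕ),
      a * ((I m).card : ℝ) ≤ (((I m).filter (fun y => y ∈ E n)).card : ℝ)) :
    ∃ a' : ℝ, 0 < a' ∧ ∃ n₁ ∈ S, {n ∈ S | ∀ᶠ m in (U : Filter ℕ),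
      a' * ((I m).card : ℝ) ≤ (((I m).filter (fun y => y ∈ E n₁ ∩ E n)).card : ℝ)}.Infinite := by
  obtain ⟨K₀, hK₀⟩ := exists_nat_gt (2 / a)
  have hK₀pos : (0 : ℝ) < K₀ := lt_trans (by positivity) hK₀
  have hKa : 2 < K₀ * a := by rwa [div_lt_iff₀ ha] at hK₀
  set a' := a / (2 * K₀) with ha'
  have ha'K : a' * K₀ = a / 2 := by rw [ha']; field_simp
  have ha'pos : 0 < a' := by positivity
  refine ⟨a', ha'pos, ?_⟩
  by_contra hcon
  push Not at hcon
  have key : ∀ K : ℕ, K ≤ K₀ → ∃ T : Finset ℕ, (∀ t ∈ T, t ∈ S) ∧ T.card ≤ K ∧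
      ∀ᶠ m in (U : Filter ℕ), (K * (a / 2)) * ((I m).card : ℝ) ≤
        (((I m).filter (fun y => ∃ t ∈ T, y ∈ E t)).card : ℝ) := by
    intro K
    induction K with
    | zero => intro _; exact ⟨∅, by simp, by simp, by simp⟩
    | succ K ih =>
      intro hK
      obtain ⟨T, hTS, hTc, hT⟩ := ih (by omega)
      have hfin : (⋃ t ∈ T, {n ∈ S | ∀ᶠ m in (U : Filter ℕ),
          a' * ((I m).card : ℝ) ≤ (((I m).filter (fun y => y ∈ E t ∩ E n)).card : ℝ)}).Finite := by
        apply Set.Finite.biUnion T.finite_toSet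
        intro t ht
        exact hcon t (hTS t ht)
      obtain ⟨n, hnS, hn⟩ := (hS.sdiff hfin).nonempty
      have hn' : ∀ t ∈ T, ∀ᶠ m in (U : Filter ℕ),
          (((I m).filter (fun y => y ∈ E t ∩ E n)).card : ℝ) ≤ a' * ((I m).card : ℝ) := by
        intro t ht
        by_contra hc
        apply hn
        simp only [Set.mem_iUnion]
        refine ⟨t, ht, hnS, ?_⟩
        rw [← Ultrafilter.eventually_not] at hc
        filter_upwards [hc] with m hm
        exact le_of_lt (not_le.mp hm)
      have hall : ∀ᶠ m in (U : Filter ℕ), ∀ t ∈ T,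
          (((I m).filter (fun y => y ∈ E t ∩ E n)).card : ℝ) ≤ a' * ((I m).card : ℝ) :=
        (eventually_all_finset T).2 hn'
      refine ⟨insert n T, ?_, (Finset.card_insert_le _ _).trans (by omega), ?_⟩
      · intro t ht
        rcases Finset.mem_insert.1 ht with rfl | ht
        · exact hnS
        · exact hTS t ht
      filter_upwards [hT, hall, h n hnS] with m h1 h2 h3
      set W := (I m).filter (fun y => ∃ t ∈ T, y ∈ E t)
      set N := (I m).filter (fun y => y ∈ E n)
      have e1 : (I m).filter (fun y => ∃ t ∈ insert n T, y ∈ E t) = W ∪ N := by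
        ext y; simp only [W, N, Finset.mem_filter, Finset.mem_union, Finset.mem_insert]
        constructor
        · rintro ⟨hy, t, rfl | ht, hyt⟩
          · exact Or.inr ⟨hy, hyt⟩
          · exact Or.inl ⟨hy, t, ht, hyt⟩
        · rintro (⟨hy, t, ht, hyt⟩ | ⟨hy, hyt⟩)
          · exact ⟨hy, t, Or.inr ht, hyt⟩
          · exact ⟨hy, n, Or.inl rfl, hyt⟩
      have e2 : ((W ∩ N).card : ℝ) ≤ K * (a' * (I m).card) := by
        have hsub : W ∩ N ⊆ T.biUnion (fun t => (I m).filter (fun y => y ∈ E t ∩ E n)) := by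
          intro y hy
          simp only [W, N, Finset.mem_filter, Finset.mem_inter, Finset.mem_biUnion] at hy ⊢
          obtain ⟨⟨hy, t, ht, hyt⟩, -, hyn⟩ := hy
          exact ⟨t, ht, hy, hyt, hyn⟩
        calc ((W ∩ N).card : ℝ) ≤
            ∑ t ∈ T, (((I m).filter (fun y => y ∈ E t ∩ E n)).card : ℝ) := by
              exact_mod_cast (Finset.card_le_card hsub).trans Finset.card_biUnion_le
          _ ≤ ∑ t ∈ T, a' * ((I m).card : ℝ) := Finset.sum_le_sum h2
          _ = T.card * (a' * ((I m).card : ℝ)) := by simp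
          _ ≤ K * (a' * ((I m).card : ℝ)) := by gcongr
      have e3 : ((W ∪ N).card : ℝ) + (W ∩ N).card = W.card + N.card := by
        exact_mod_cast Finset.card_union_add_card_inter W N
      rw [e1]
      have e4 : (K : ℝ) * (a' * (I m).card) ≤ a / 2 * (I m).card := by
        rw [← ha'K]
        have : (K : ℝ) ≤ K₀ := by exact_mod_cast (by omega : K ≤ K₀)
        have h5 : 0 ≤ a' * ((I m).card : ℝ) := by positivity
        nlinarith
      push_cast
      nlinarith
  obtain ⟨T, -, -, hT⟩ := key K₀ le_rfl
  obtain ⟨m, hm⟩ := hT.exists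
  have h1 : (((I m).filter (fun y => ∃ t ∈ T, y ∈ E t)).card : ℝ) ≤ (I m).card := by
    exact_mod_cast Finset.card_filter_le _ _
  have h2 : (0 : ℝ) < (I m).card := by exact_mod_cast (hI m).card_pos
  nlinarith

open Filter Classical in
lemma large_seq (U : Ultrafilter ℕ) (hU : (U : Filter ℕ) ≤ atTop) (I : ℕ → Finset ℕ)
    (hI : ∀ m, m < (I m).card)
    (E : ℕ → Set ℕ) (a : ℝ) (ha : 0 < a)
    (h : ∀ n, ∀ᶠ m in (U : Filter ℕ),
      a * ((I m).card : ℝ) ≤ (((I m).filter (fun y => y ∈ E n)).card : ℝ)) :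
    ∃ f : ℕ → ℕ, StrictMono f ∧ ∀ k, {y | ∀ i ≤ k, y ∈ E (f i)}.Infinite := by
  let inv : Set ℕ × Set ℕ × ℝ → Prop := fun p => p.2.1.Infinite ∧ 0 < p.2.2 ∧
    ∀ n ∈ p.2.1, ∀ᶠ m in (U : Filter ℕ),
      p.2.2 * ((I m).card : ℝ) ≤ (((I m).filter (fun y => y ∈ p.1 ∩ E n)).card : ℝ)
  have step : ∀ s : {p // inv p}, ∃ (n : ℕ) (s' : {p // inv p}), n ∈ s.1.2.1 ∧
      s'.1.1 = s.1.1 ∩ E n ∧ s'.1.2.1 ⊆ s.1.2.1 ∩ Set.Ioi n := by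
    rintro ⟨⟨X, S, r⟩, hS, hr, hs⟩
    obtain ⟨r', hr', n, hn, hinf⟩ := large_pair U I
      (fun m => Finset.card_pos.1 (lt_of_le_of_lt (Nat.zero_le _) (hI m)))
      (fun n => X ∩ E n) S hS r hr (by intro n hn; convert hs n hn)
    refine ⟨n, ⟨⟨X ∩ E n, _ \ Set.Iic n, r'⟩, hinf.sdiff (Set.finite_Iic n), hr', ?_⟩, hn, rfl, ?_⟩
    · rintro k ⟨⟨hkS, hk⟩, -⟩
      filter_upwards [hk] with m hm
      refine hm.trans ?_
      norm_cast
      apply Finset.card_le_card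
      intro y
      simp only [Finset.mem_filter, Set.mem_inter_iff]
      tauto
    · rintro k ⟨⟨hkS, hk⟩, hkn⟩
      exact ⟨hkS, by simpa using hkn⟩
  choose pick nxt h1 h2 h3 using step
  let start : {p // inv p} := ⟨⟨Set.univ, Set.univ, a⟩, Set.infinite_univ, ha, by
    intro n _; simpa using h n⟩
  let st : ℕ → {p // inv p} := fun k => Nat.rec start (fun _ s => nxt s) k
  have hst : ∀ k, st (k + 1) = nxt (st k) := fun k => rfl
  refine ⟨fun k => pick (st k), ?_, ?_⟩
  · apply strictMono_nat_of_lt_succ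
    intro k
    have := h3 (st k) (h1 (nxt (st k)))
    exact this.2
  · intro k
    have hX : ∀ k, ∀ i < k, (st k).1.1 ⊆ E (pick (st i)) := by
      intro k
      induction k with
      | zero => intro i hi; omega
      | succ k ih =>
        intro i hi
        rw [hst, h2]
        rcases Nat.lt_succ_iff_lt_or_eq.1 hi with hi | rfl
        · exact Set.inter_subset_left.trans (ih i hi)
        · exact Set.inter_subset_right
    obtain ⟨hS, hr, hs⟩ := (st (k+1)).2
    obtain ⟨n, hn⟩ := hS.nonempty
    have hev := hs n hn
    set r := (st (k+1)).1.2.2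
    intro hfin
    have hle : ∀ m, ((I m).filter (fun y => y ∈ (st (k+1)).1.1 ∩ E n)).card
        ≤ hfin.toFinset.card := by
      intro m
      apply Finset.card_le_card
      intro y hy
      simp only [Finset.mem_filter] at hy
      simp only [Set.Finite.mem_toFinset, Set.mem_ofPred_eq]
      intro i hi
      exact hX (k+1) i (by omega) hy.2.1
    obtain ⟨M, hM⟩ := exists_nat_gt ((hfin.toFinset.card : ℝ) / r)
    obtain ⟨m, hm, hmM⟩ := (hev.and (hU (eventually_ge_atTop M))).exists
    rw [div_lt_iff₀ hr] at hM
    have h5 : (M : ℝ) ≤ (I m).card := by exact_mod_cast (lt_of_le_of_lt hmM (hI m)).le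
    have h6 : (((I m).filter (fun y => y ∈ (st (k+1)).1.1 ∩ E n)).card : ℝ)
        ≤ hfin.toFinset.card := by exact_mod_cast hle m
    nlinarith

open Classical in
lemma shift_count (D : Set ℕ) (s n l : ℕ) :
    ((Finset.Ico s (s+n)).filter (fun y => y ∈ D)).card ≤
      ((Finset.Ico s (s+n)).filter (fun y => y + l ∈ D)).card + l := by
  have : (Finset.Ico s (s+n)).filter (fun y => y ∈ D) ⊆
      (((Finset.Ico s (s+n)).filter (fun y => y + l ∈ D)).image (fun y => y + l)) ∪
        Finset.Ico s (s + l) := by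
    intro y hy
    simp only [Finset.mem_filter, Finset.mem_Ico, Finset.mem_union, Finset.mem_image] at hy ⊢
    by_cases hyl : y < s + l
    · right; omega
    · left
      refine ⟨y - l, ⟨⟨by omega, by omega⟩, ?_⟩, by omega⟩
      rw [Nat.sub_add_cancel (by omega)]; exact hy.2
  refine (Finset.card_le_card this).trans ((Finset.card_union_le _ _).trans ?_)
  have := Finset.card_image_le (s := (Finset.Ico s (s+n)).filter (fun y => y + l ∈ D))
    (f := fun y => y + l)
  simp only [Nat.card_Ico]
  omega

open Filter Classical in
lemma dense_sumset (D : Set ℕ) (s len : ℕ → ℕ) (hlen : ∀ m, m < len m)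
    (hD : ∀ m, 15 * len m ≤ 16 * ((Finset.Ico (s m) (s m + len m)).filter (fun y => y ∈ D)).card) :
    ∃ b c : ℕ → ℕ, (∀ k, k ≤ b k) ∧ (∀ k, k ≤ c k) ∧ ∀ i j, b i + c j ∈ D := by
  set I : ℕ → Finset ℕ := fun m => Finset.Ico (s m) (s m + len m) with hIdef
  have hIc : ∀ m, (I m).card = len m := by intro m; simp [I]
  have hshift : ∀ m l, 16 * l ≤ len m →
      7 * len m ≤ 8 * ((I m).filter (fun y => y + l ∈ D)).card := by
    intro m l hl
    have := shift_count D (s m) (len m) l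
    have := hD m
    simp only [I]
    omega
  set U : Ultrafilter ℕ := hyperfilter ℕ
  have hU : (U : Filter ℕ) ≤ atTop := Nat.hyperfilter_le_atTop
  -- step 1
  set G : ℕ → Set ℕ := fun m => {x | 3 * len m ≤ 4 * ((I m).filter (fun l => x + l ∈ D)).card}
    with hG
  have hGl : ∀ m, ∀ᶠ N in (U : Filter ℕ),
      (1/2 : ℝ) * ((I N).card : ℝ) ≤ (((I N).filter (fun y => y ∈ G m)).card : ℝ) := by
    intro m
    filter_upwards [hU (eventually_ge_atTop (16 * (s m + len m)))] with N hN
    have h1 : ∀ l ∈ I m, 7 * len N ≤ 8 * ((I N).filter (fun y => y + l ∈ D)).card := by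
      intro l hl
      apply hshift
      simp only [I, Finset.mem_Ico] at hl
      have := hlen N
      omega
    have hdc : ∑ l ∈ I m, ((I N).filter (fun y => y + l ∈ D)).card =
        ∑ y ∈ I N, ((I m).filter (fun l => y + l ∈ D)).card := by
      simp only [Finset.card_filter]
      rw [Finset.sum_comm]
    have hlow : len m * (7 * len N) ≤ 8 * ∑ y ∈ I N, ((I m).filter (fun l => y + l ∈ D)).card := by
      rw [← hdc, Finset.mul_sum]
      have := Finset.sum_le_sum h1
      simpa [hIc] using this
    have hup : ∀ y ∈ I N, 4 * ((I m).filter (fun l => y + l ∈ D)).card ≤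
        3 * len m + (if y ∈ G m then len m else 0) := by
      intro y hy
      split_ifs with hyG
      · have := Finset.card_filter_le (I m) (fun l => y + l ∈ D)
        rw [hIc] at this
        omega
      · simp only [G, Set.mem_ofPred_eq] at hyG
        omega
    have hup2 := Finset.sum_le_sum hup
    rw [← Finset.mul_sum, Finset.sum_add_distrib, ← Finset.sum_filter] at hup2
    simp only [Finset.sum_const, smul_eq_mul, hIc] at hup2
    rw [hIc]
    set g := ((I N).filter (fun y => y ∈ G m)).card
    have hm : 0 < len m := lt_of_le_of_lt (Nat.zero_le _) (hlen m)
    have h2 : len m * (7 * len N) ≤ len m * (6 * len N + 2 * g) := by nlinarith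
    have h3 := Nat.le_of_mul_le_mul_left h2 hm
    have h4 : (len N : ℝ) ≤ 2 * g := by exact_mod_cast (by omega : len N ≤ 2 * g)
    linarith
  obtain ⟨f, hf, hfinf⟩ := large_seq U hU I (by simpa [hIc] using hlen) G (1/2) (by norm_num)
    (by intro n; convert hGl n)
  have hx : ∀ k, ∃ x, k ≤ x ∧ ∀ i ≤ k, x ∈ G (f i) := by
    intro k
    obtain ⟨x, hx, hk⟩ := (hfinf k).exists_gt k
    exact ⟨x, hk.le, hx⟩
  choose x hxk hxG using hx
  set L : Set ℕ := {l | ∀ᶠ k in (U : Filter ℕ), x k + l ∈ D} with hL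
  have hLiff : ∀ l, ∀ᶠ k in (U : Filter ℕ), (x k + l ∈ D ↔ l ∈ L) := by
    intro l
    by_cases hl : l ∈ L
    · filter_upwards [hl] with k hk
      tauto
    · have : ∀ᶠ k in (U : Filter ℕ), ¬ (x k + l ∈ D) := Ultrafilter.eventually_not.2 hl
      filter_upwards [this] with k hk
      tauto
  have hLd : ∀ i, 3 * len (f i) ≤ 4 * ((I (f i)).filter (fun l => l ∈ L)).card := by
    intro i
    have h1 : ∀ᶠ k in (U : Filter ℕ), ∀ l ∈ I (f i), (x k + l ∈ D ↔ l ∈ L) :=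
      (eventually_all_finset _).2 fun l _ => hLiff l
    obtain ⟨k, hk, hki⟩ := (h1.and (hU (eventually_ge_atTop i))).exists
    have := hxG k i hki
    simp only [G, Set.mem_ofPred_eq] at this
    rwa [Finset.filter_congr hk] at this
  have hc : ∀ n, ∃ c, n ≤ c ∧ ∀ l ∈ L, l ≤ n → c + l ∈ D := by
    intro n
    have h1 : ∀ᶠ k in (U : Filter ℕ), ∀ l ∈ Finset.range (n+1), (x k + l ∈ D ↔ l ∈ L) :=
      (eventually_all_finset _).2 fun l _ => hLiff l
    obtain ⟨k, hk, hki⟩ := (h1.and (hU (eventually_ge_atTop n))).exists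
    exact ⟨x k, le_trans hki (hxk k), fun l hl hln =>
      (hk l (Finset.mem_range.2 (by omega))).2 hl⟩
  choose c hcn hcL using hc
  -- step 2
  have hEl : ∀ n, ∀ᶠ i in (U : Filter ℕ), (1/2 : ℝ) * ((I (f i)).card : ℝ) ≤
      (((I (f i)).filter (fun y => y ∈ {y | y ∈ L ∧ y + c n ∈ D})).card : ℝ) := by
    intro n
    filter_upwards [hU (eventually_ge_atTop (16 * c n))] with i hi
    have h1 := hLd i
    have h2 := hshift (f i) (c n) (by have := hf.le_apply (x := i); have := hlen (f i); omega)
    have h3 := Finset.card_union_add_card_inter ((I (f i)).filter (fun l => l ∈ L))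
      ((I (f i)).filter (fun y => y + c n ∈ D))
    have h4 : ((I (f i)).filter (fun l => l ∈ L) ∪
      (I (f i)).filter (fun y => y + c n ∈ D)).card ≤ len (f i) := by
      rw [← hIc]
      exact Finset.card_le_card (Finset.union_subset (Finset.filter_subset _ _)
        (Finset.filter_subset _ _))
    rw [← Finset.filter_and] at h3
    suffices hh : (1/2 : ℝ) * ((I (f i)).card : ℝ) ≤
        (((I (f i)).filter (fun y => y ∈ L ∧ y + c n ∈ D)).card : ℝ) by
      convert hh
    rw [hIc]
    set g := ((I (f i)).filter (fun y => y ∈ L ∧ y + c n ∈ D)).card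
    have h5 : (len (f i) : ℝ) ≤ 2 * g := by exact_mod_cast (by omega : len (f i) ≤ 2 * g)
    linarith
  obtain ⟨g, hg, hginf⟩ := large_seq U hU (fun i => I (f i))
    (by intro i; rw [hIc]; exact lt_of_le_of_lt hf.le_apply (hlen (f i)))
    (fun n => {y | y ∈ L ∧ y + c n ∈ D}) (1/2) (by norm_num)
    (by intro n; convert hEl n)
  have hb : ∀ k, ∃ b, k ≤ b ∧ ∀ i ≤ k, b ∈ L ∧ b + c (g i) ∈ D := by
    intro k
    obtain ⟨x, hx, hk⟩ := (hginf k).exists_gt k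
    exact ⟨x, hk.le, hx⟩
  choose b hbk hbD using hb
  let φ : ℕ → ℕ := fun t => Nat.rec 0 (fun _ p => b p + 1) t
  have hφs : ∀ t, φ (t+1) = b (φ t) + 1 := fun t => rfl
  have hφ : StrictMono φ := strictMono_nat_of_lt_succ fun t => by
    rw [hφs]; have := hbk (φ t); omega
  refine ⟨fun t => b (φ t), fun t => c (g (φ t)), fun t => hφ.le_apply.trans (hbk _),
    fun t => hφ.le_apply.trans (hg.le_apply.trans (hcn _)), ?_⟩
  intro i j
  rcases le_or_gt j i with hji | hij
  · exact (hbD (φ i) (φ j) (hφ.monotone hji)).2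
  · have h1 : φ (i+1) ≤ φ j := hφ.monotone hij
    rw [hφs] at h1
    have h2 : φ j ≤ g (φ j) := hg.le_apply
    have := hcL (g (φ j)) (b (φ i)) (hbD (φ i) 0 (Nat.zero_le _)).1 (by omega)
    rwa [add_comm] at this

lemma infinite_range_of_ge (u : ℕ → ℕ) (h : ∀ t, t ≤ u t) : (Set.range u).Infinite := by
  apply Set.infinite_of_forall_exists_gt
  intro a
  exact ⟨u (a+1), ⟨a+1, rfl⟩, by have := h (a+1); omega⟩

open Filter in
lemma ramsey_part (A : Set ℕ) (K : ℕ) (b c : ℕ → ℕ) (hb : ∀ k, k ≤ b k) (hc : ∀ k, k ≤ c k)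
    (h : ∀ i j, ∃ a ∈ A, ∃ e ≤ K, b i + c j = a + e) :
    ∃ B C : Set ℕ, ∃ k : ℕ, B.Infinite ∧ C.Infinite ∧
      ∀ b ∈ B, ∀ c ∈ C, b + c ∈ A ∪ (fun a => a + k) '' A := by
  set U : Ultrafilter ℕ := hyperfilter ℕ
  have hU : (U : Filter ℕ) ≤ atTop := Nat.hyperfilter_le_atTop
  have pig : ∀ R : ℕ → ℕ → Prop, (∀ i, ∃ e ≤ K, R i e) →
      ∃ e ≤ K, ∀ᶠ i in (U : Filter ℕ), R i e := by
    intro R hR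
    by_contra hcon
    push Not at hcon
    have h1 : ∀ᶠ i in (U : Filter ℕ), ∀ e ∈ Finset.range (K+1), ¬ R i e :=
      (eventually_all_finset _).2 fun e he =>
        by simpa using hcon e (by simpa [Nat.lt_succ_iff] using he)
    obtain ⟨i, hi⟩ := h1.exists
    obtain ⟨e, he, hr⟩ := hR i
    exact hi e (by simpa [Nat.lt_succ_iff] using he) hr
  obtain ⟨α, -, hα⟩ := pig (fun i e => ∀ᶠ j in (U : Filter ℕ), ∃ a ∈ A, b i + c j = a + e)
    (fun i => pig (fun j e => ∃ a ∈ A, b i + c j = a + e)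
      (fun j => by obtain ⟨a, ha, e, he, h⟩ := h i j; exact ⟨e, he, a, ha, h⟩))
  obtain ⟨β, -, hβ⟩ := pig (fun j e => ∀ᶠ i in (U : Filter ℕ), ∃ a ∈ A, b i + c j = a + e)
    (fun j => pig (fun i e => ∃ a ∈ A, b i + c j = a + e)
      (fun i => by obtain ⟨a, ha, e, he, h⟩ := h i j; exact ⟨e, he, a, ha, h⟩))
  obtain ⟨k, hkP, hkr⟩ := exists_seq_of_forall_finset_exists
    (fun k => (∀ᶠ j in (U : Filter ℕ), ∃ a ∈ A, b k + c j = a + α) ∧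
      (∀ᶠ i in (U : Filter ℕ), ∃ a ∈ A, b i + c k = a + β))
    (fun x y => x < y ∧ (∃ a ∈ A, b x + c y = a + α) ∧ (∃ a ∈ A, b y + c x = a + β)) (by
      intro s hs
      have h1 : ∀ᶠ y in (U : Filter ℕ), ∀ x ∈ s,
          x < y ∧ (∃ a ∈ A, b x + c y = a + α) ∧ (∃ a ∈ A, b y + c x = a + β) :=
        (eventually_all_finset _).2 fun x hx =>
          Eventually.and (hU (eventually_gt_atTop x)) ((hs x hx).1.and (hs x hx).2)
      obtain ⟨y, hy1, hy2⟩ := ((hα.and hβ).and h1).exists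
      exact ⟨y, hy1, hy2⟩)
  have hk : StrictMono k := fun m n hmn => (hkr m n hmn).1
  have hmain : ∀ s t, (∃ a ∈ A, b (k (2*s)) + c (k (2*t+1)) = a + α) ∨
      (∃ a ∈ A, b (k (2*s)) + c (k (2*t+1)) = a + β) := by
    intro s t
    rcases lt_or_gt_of_ne (by omega : 2*s ≠ 2*t+1) with h | h
    · exact Or.inl (hkr _ _ h).2.1
    · exact Or.inr (hkr _ _ h).2.2
  have hbk : ∀ t, t ≤ b (k t) := fun t => hk.le_apply.trans (hb _)
  have hck : ∀ t, t ≤ c (k t) := fun t => hk.le_apply.trans (hc _)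
  refine ⟨Set.range (fun t => b (k (2 * (t + (min α β)))) - min α β),
    Set.range (fun t => c (k (2*t+1))), max α β - min α β,
    infinite_range_of_ge _ (fun t => ?_), infinite_range_of_ge _ (fun t => ?_), ?_⟩
  · have := hbk (2 * (t + (min α β)))
    omega
  · have := hck (2*t+1)
    omega
  · rintro _ ⟨s, rfl⟩ _ ⟨t, rfl⟩
    have h0 := hbk (2 * (s + (min α β)))
    have key : ∃ a ∈ A, b (k (2 * (s + min α β))) + c (k (2*t+1)) = a + min α β ∨
        b (k (2 * (s + min α β))) + c (k (2*t+1)) = a + max α β := by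
      rcases le_total α β with hab | hab <;>
      rcases hmain (s + min α β) t with ⟨a, ha, h⟩ | ⟨a, ha, h⟩ <;>
      refine ⟨a, ha, ?_⟩ <;> omega
    obtain ⟨a, ha, h | h⟩ := key
    · left
      convert ha using 1
      dsimp only
      omega
    · right
      refine ⟨a, ha, ?_⟩
      dsimp only
      omega

open Filter Classical in
lemma hindman_part (A : Set ℕ) (hA : 0 < banachDensity A) : ∃ K : ℕ, ∀ N : ℕ, ∃ s n : ℕ, N < n ∧
    15 * n ≤ 16 * ((Finset.Ico s (s + n)).filter
      (fun y => y ∈ {y | ∃ a ∈ A, ∃ e ≤ K, y = a + e})).card := by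
  set β := banachDensity A with hβ
  set S : ℕ → ℕ → ℝ := fun n m => (Nat.card ↥(A ∩ Set.Icc m (m + n)) : ℝ) / n with hS
  have hcard : ∀ m n, Nat.card ↥(A ∩ Set.Icc m (m + n)) =
      ((Finset.Icc m (m+n)).filter (fun y => y ∈ A)).card := by
    intro m n
    rw [Nat.card_coe_set_eq, ← Set.ncard_coe_finset]
    congr 1
    ext y
    simp [and_comm]
  have hS2 : ∀ n m, S n m ≤ 2 := by
    intro n m
    simp only [S]
    rw [hcard]
    rcases Nat.eq_zero_or_pos n with rfl | hn
    · simp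
    · have hn' : (0 : ℝ) < n := by exact_mod_cast hn
      rw [div_le_iff₀ hn']
      have h1 := Finset.card_filter_le (Finset.Icc m (m+n)) (fun y => y ∈ A)
      simp only [Nat.card_Icc] at h1
      exact_mod_cast (by omega :
        ((Finset.Icc m (m+n)).filter (fun y => y ∈ A)).card ≤ 2 * n)
  have hS0 : ∀ n m, 0 ≤ S n m := fun n m => by simp only [S]; positivity
  have hbdd : ∀ n, BddAbove (Set.range (S n)) := fun n => ⟨2, by rintro _ ⟨m, rfl⟩; exact hS2 n m⟩
  have hsup2 : ∀ n, (⨆ m, S n m) ≤ 2 := fun n => ciSup_le (hS2 n)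
  have hsup0 : ∀ n, 0 ≤ (⨆ m, S n m) := fun n => Real.iSup_nonneg (hS0 n)
  have hlim : limsup (fun n => ⨆ m, S n m) atTop = β := rfl
  have hB1 : IsBoundedUnder (· ≤ ·) atTop (fun n => ⨆ m, S n m) := isBoundedUnder_of ⟨2, hsup2⟩
  have hB2 : IsCoboundedUnder (· ≤ ·) atTop (fun n => ⨆ m, S n m) :=
    (isBoundedUnder_of (r := (· ≥ ·)) ⟨0, hsup0⟩).isCoboundedUnder_le
  have hev : ∀ᶠ n in atTop, (⨆ m, S n m) < β * (101/100) :=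
    eventually_lt_of_limsup_lt (by rw [hlim]; linarith) hB1
  have hfr : ∃ᶠ n in atTop, β * (99/100) < (⨆ m, S n m) :=
    frequently_lt_of_lt_limsup hB2 (by rw [hlim]; linarith)
  obtain ⟨H, hH, hHpos⟩ := (hev.and (eventually_ge_atTop 1)).exists
  have hblock : ∀ m, (((Finset.Ico m (m+H)).filter (fun y => y ∈ A)).card : ℝ)
      ≤ β * (101/100) * H := by
    intro m
    have h1 : S H m < β * (101/100) := lt_of_le_of_lt (le_ciSup (hbdd H) m) hH
    simp only [S] at h1
    rw [hcard, div_lt_iff₀ (by exact_mod_cast hHpos)] at h1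
    refine le_trans ?_ h1.le
    norm_cast
    apply Finset.card_le_card
    apply Finset.filter_subset_filter
    exact Finset.Ico_subset_Icc_self
  refine ⟨2 * H, fun N => ?_⟩
  obtain ⟨n, hn, hnN⟩ := (hfr.and_eventually (eventually_ge_atTop (N + 100 * H))).exists
  obtain ⟨m, hm⟩ := exists_lt_of_lt_ciSup hn
  simp only [S] at hm
  have hn0 : 0 < n := by omega
  rw [hcard, lt_div_iff₀ (by exact_mod_cast hn0)] at hm
  set q := n / H + 1 with hq
  have hdm := Nat.div_add_mod n H
  have hml := Nat.mod_lt n hHpos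
  have hq1 : q * H = H * (n / H) + H := by rw [hq]; ring
  set T := (Finset.range q).filter (fun j => ∃ a ∈ A, m + j * H ≤ a ∧ a < m + j * H + H) with hT
  have hup : ((Finset.Icc m (m+n)).filter (fun y => y ∈ A)).card ≤
      ∑ j ∈ T, ((Finset.Ico (m + j * H) (m + j * H + H)).filter (fun y => y ∈ A)).card := by
    refine le_trans (Finset.card_le_card ?_) Finset.card_biUnion_le
    intro y hy
    simp only [Finset.mem_filter, Finset.mem_Icc] at hy
    simp only [Finset.mem_biUnion, T, Finset.mem_filter, Finset.mem_range, Finset.mem_Ico]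
    have e1 := Nat.div_add_mod (y - m) H
    have e2 := Nat.mod_lt (y - m) hHpos
    have e3 : (y - m) / H * H = H * ((y - m) / H) := mul_comm _ _
    have e4 : (y - m) / H ≤ n / H := Nat.div_le_div_right (by omega)
    refine ⟨(y - m) / H, ⟨by omega, y, hy.2, by omega, by omega⟩, ⟨by omega, by omega⟩, hy.2⟩
  have hup' : (((Finset.Icc m (m+n)).filter (fun y => y ∈ A)).card : ℝ) ≤
      T.card * (β * (101/100) * H) := by
    calc (((Finset.Icc m (m+n)).filter (fun y => y ∈ A)).card : ℝ) ≤ ∑ j ∈ T,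
          (((Finset.Ico (m + j * H) (m + j * H + H)).filter (fun y => y ∈ A)).card : ℝ) := by
          exact_mod_cast hup
      _ ≤ ∑ j ∈ T, (β * (101/100) * H) := Finset.sum_le_sum fun j _ => hblock _
      _ = _ := by simp
  have hTn : 99 * n ≤ 101 * (T.card * H) := by
    have h1 : β * (99 * n) < β * (101 * (T.card * H)) := by nlinarith
    have h2 := lt_of_mul_lt_mul_left h1 hA.le
    exact_mod_cast h2.le
  have hlow : T.card * H ≤ ((Finset.Ico (m + H) (m + H + q * H)).filter
      (fun y => y ∈ {y | ∃ a ∈ A, ∃ e ≤ 2 * H, y = a + e})).card := by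
    have h1 : (T.biUnion (fun j => Finset.Ico (m + H + j * H) (m + H + j * H + H))).card =
        T.card * H := by
      rw [Finset.card_biUnion]
      · simp
      · intro i _ j _ hij
        refine Finset.disjoint_left.2 ?_
        intro y h1 h2
        simp only [Finset.mem_Ico] at h1 h2
        rcases lt_or_gt_of_ne hij with h | h
        · have : (i + 1) * H ≤ j * H := Nat.mul_le_mul_right _ h
          rw [add_mul] at this; omega
        · have : (j + 1) * H ≤ i * H := Nat.mul_le_mul_right _ h
          rw [add_mul] at this; omega
    rw [← h1]
    apply Finset.card_le_card
    intro y hy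
    simp only [Finset.mem_biUnion, T, Finset.mem_filter, Finset.mem_range, Finset.mem_Ico] at hy
    simp only [Finset.mem_filter, Finset.mem_Ico, Set.mem_ofPred_eq]
    obtain ⟨j, ⟨hj, a, ha, ha1, ha2⟩, hy1, hy2⟩ := hy
    have : (j + 1) * H ≤ q * H := Nat.mul_le_mul_right _ hj
    rw [add_mul] at this
    exact ⟨⟨by omega, by omega⟩, a, ha, y - a, by omega, by omega⟩
  refine ⟨m + H, q * H, by omega, ?_⟩
  omega

theorem erdos_one_shift (A : Set ℕ) (hA : 0 < banachDensity A) :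
    ∃ B C : Set ℕ, ∃ k : ℕ, B.Infinite ∧ C.Infinite ∧
      ∀ b ∈ B, ∀ c ∈ C, b + c ∈ A ∪ (fun a => a + k) '' A := by
  obtain ⟨K, hK⟩ := hindman_part A hA
  choose s n hn hd using hK
  obtain ⟨b, c, hb, hc, h⟩ := dense_sumset _ s n hn hd
  exact ramsey_part A K b c hb hc h
end

section
/- Let A ⊆ ℕ satisfy BD(A) > 1/2. Then there exist infinite sets B, C ⊆ ℕ such that B + C ⊆ A. -/
open Filter Topology

open Classical in
/-- The number of elements of `X` in `[a, a + l)`. -/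
noncomputable def cntIco (X : Set ℕ) (a l : ℕ) : ℕ :=
  ((Finset.Ico a (a + l)).filter (fun x => x ∈ X)).card

lemma cntIco_le (X : Set ℕ) (a l : ℕ) : cntIco X a l ≤ l := by
  classical
  unfold cntIco
  refine (Finset.card_filter_le _ _).trans ?_
  simp

lemma cntIco_mono {X Y : Set ℕ} (h : X ⊆ Y) (a l : ℕ) : cntIco X a l ≤ cntIco Y a l := by
  classical
  unfold cntIco
  apply Finset.card_le_card
  intro x hx
  simp only [Finset.mem_filter] at hx ⊢
  exact ⟨hx.1, h hx.2⟩

lemma cntIco_union (X Y : Set ℕ) (a l : ℕ) :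
    cntIco (X ∪ Y) a l + cntIco (X ∩ Y) a l = cntIco X a l + cntIco Y a l := by
  classical
  unfold cntIco
  simp only [Set.mem_union, Set.mem_inter_iff]
  rw [Finset.filter_or, Finset.filter_and, Finset.card_union_add_card_inter]

lemma cntIco_shift (X : Set ℕ) (i a l : ℕ) :
    cntIco X a l ≤ cntIco {x | x + i ∈ X} a l + i := by
  classical
  unfold cntIco
  have : (Finset.Ico a (a + l)).filter (fun x => x ∈ X) ⊆
      (((Finset.Ico a (a + l)).filter (fun x => x ∈ {x | x + i ∈ X})).image (· + i)) ∪
        Finset.Ico a (a + i) := by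
    intro x hx
    simp only [Finset.mem_filter, Finset.mem_Ico, Finset.mem_union, Finset.mem_image,
      Set.mem_ofPred_eq] at hx ⊢
    by_cases h : x < a + i
    · right; omega
    · left
      refine ⟨x - i, ⟨by omega, ?_⟩, by omega⟩
      rw [Nat.sub_add_cancel (by omega)]; exact hx.2
  refine (Finset.card_le_card this).trans ((Finset.card_union_le _ _).trans ?_)
  refine Nat.add_le_add Finset.card_image_le ?_
  simp

lemma cntIco_finite {X : Set ℕ} (hX : X.Finite) : ∃ C, ∀ a l, cntIco X a l ≤ C := by
  classical
  refine ⟨hX.toFinset.card, fun a l => ?_⟩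
  unfold cntIco
  apply Finset.card_le_card
  intro x hx
  simp only [Finset.mem_filter] at hx
  simpa using hx.2

/-- A finitely additive mean obtained from a sequence of intervals. -/
structure MeanFor (a l : ℕ → ℕ) (U : Ultrafilter ℕ) (μ : Set ℕ → ℝ) : Prop where
  tend : ∀ X, Tendsto (fun n => (cntIco X (a n) (l n) : ℝ) / (l n)) U (𝓝 (μ X))

lemma exists_mean (a l : ℕ → ℕ) (U : Ultrafilter ℕ) : ∃ μ, MeanFor a l U μ := by
  have : ∀ X : Set ℕ, ∃ r : ℝ,
      Tendsto (fun n => (cntIco X (a n) (l n) : ℝ) / (l n)) U (𝓝 r) := by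
    intro X
    have hc : IsCompact (Set.Icc (0:ℝ) 1) := isCompact_Icc
    obtain ⟨r, _, hr⟩ := hc.ultrafilter_le_nhds
      (U.map (fun n => (cntIco X (a n) (l n) : ℝ) / (l n))) (by
        simp only [le_principal_iff, Ultrafilter.mem_coe]
        rw [Ultrafilter.mem_map]
        apply Filter.univ_mem'
        intro n
        simp only [Set.mem_preimage, Set.mem_Icc]
        refine ⟨by positivity, ?_⟩
        apply div_le_one_of_le₀
        · exact_mod_cast cntIco_le _ _ _
        · positivity)
    exact ⟨r, hr⟩
  choose μ hμ using this
  exact ⟨μ, ⟨hμ⟩⟩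

section mean
variable {a l : ℕ → ℕ} {U : Ultrafilter ℕ} {μ : Set ℕ → ℝ}

lemma MeanFor.mono (h : MeanFor a l U μ) {X Y : Set ℕ} (hXY : X ⊆ Y) : μ X ≤ μ Y := by
  refine le_of_tendsto_of_tendsto' (h.tend X) (h.tend Y) fun n => ?_
  have := cntIco_mono hXY (a n) (l n)
  gcongr

lemma MeanFor.le_one (h : MeanFor a l U μ) (X : Set ℕ) : μ X ≤ 1 := by
  refine le_of_tendsto' (h.tend X) fun n => ?_
  apply div_le_one_of_le₀
  · exact_mod_cast cntIco_le _ _ _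
  · positivity

lemma MeanFor.union (h : MeanFor a l U μ) (X Y : Set ℕ) :
    μ (X ∪ Y) + μ (X ∩ Y) = μ X + μ Y := by
  refine tendsto_nhds_unique ((h.tend (X ∪ Y)).add (h.tend (X ∩ Y))) ?_
  refine ((h.tend X).add (h.tend Y)).congr fun n => ?_
  rw [← add_div, ← add_div]
  congr 1
  exact_mod_cast (cntIco_union X Y (a n) (l n)).symm

lemma MeanFor.empty (h : MeanFor a l U μ) : μ ∅ = 0 := by
  refine tendsto_nhds_unique (h.tend ∅) ?_
  simp [cntIco]

lemma tendsto_const_div (hU : (U : Filter ℕ) ≤ atTop) (hl : ∀ n, n < l n) (C : ℝ) :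
    Tendsto (fun n => C / (l n : ℝ)) U (𝓝 0) := by
  have h1 : Tendsto l atTop atTop := tendsto_atTop_mono (fun n => (hl n).le) tendsto_id
  have h2 : Tendsto (fun n => (l n : ℝ)) atTop atTop := tendsto_natCast_atTop_atTop.comp h1
  exact (h2.const_div_atTop C).mono_left hU

lemma MeanFor.infinite (h : MeanFor a l U μ) (hU : (U : Filter ℕ) ≤ atTop)
    (hl : ∀ n, n < l n) {X : Set ℕ} (hX : 0 < μ X) : X.Infinite := by
  intro hf
  obtain ⟨C, hC⟩ := cntIco_finite hf
  have := le_of_tendsto_of_tendsto' (h.tend X) (tendsto_const_div hU hl (C : ℝ)) (fun n => by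
    have := hC (a n) (l n)
    gcongr)
  linarith

lemma MeanFor.shift (h : MeanFor a l U μ) (hU : (U : Filter ℕ) ≤ atTop)
    (hl : ∀ n, n < l n) (X : Set ℕ) (i : ℕ) : μ X ≤ μ {x | x + i ∈ X} := by
  have := le_of_tendsto_of_tendsto' (h.tend X)
    ((h.tend {x | x + i ∈ X}).add (tendsto_const_div hU hl (i : ℝ))) (fun n => by
    have := cntIco_shift X i (a n) (l n)
    rw [← add_div]
    gcongr
    exact_mod_cast this)
  linarith

lemma MeanFor.ge (h : MeanFor a l U μ) {X : Set ℕ} {α : ℝ} (hl : ∀ n, n < l n)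
    (hX : ∀ n, α * l n ≤ cntIco X (a n) (l n)) : α ≤ μ X := by
  refine ge_of_tendsto' (h.tend X) fun n => ?_
  have : (0:ℝ) < l n := by exact_mod_cast (Nat.zero_le n).trans_lt (hl n)
  rw [le_div_iff₀ this]; exact hX n

/-- One step of the intersection lemma. -/
lemma MeanFor.step (h : MeanFor a l U μ) (X : ℕ → Set ℕ) {S : Set ℕ} (hS : S.Infinite)
    {δ : ℝ} (hδ : 0 < δ) (hX : ∀ n ∈ S, δ ≤ μ (X n)) :
    ∃ δ' > 0, ∃ n ∈ S, {m ∈ S | n < m ∧ δ' ≤ μ (X n ∩ X m)}.Infinite := by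
  obtain ⟨K, hK⟩ := exists_nat_gt (2 / δ)
  have hKpos : (0:ℝ) < K := lt_trans (by positivity) hK
  have hK2 : 2 < K * δ := by rwa [div_lt_iff₀ hδ] at hK
  refine ⟨1 / (K:ℝ)^2, by positivity, ?_⟩
  by_contra! hcon
  set δ' : ℝ := 1 / (K:ℝ)^2 with hδ'
  have key : ∀ j : ℕ, ∃ F : Finset ℕ, F.card = j ∧
      (j * δ - j^2 * δ' ≤ μ (⋃ i ∈ F, X i)) ∧
      (∀ i ∈ F, i ∈ S) := by
    intro j
    induction j with
    | zero => exact ⟨∅, by simp [h.empty]⟩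
    | succ j ih =>
      obtain ⟨F, hF, hm, hFS⟩ := ih
      have hfin : (⋃ n ∈ F, {m ∈ S | n < m ∧ δ' ≤ μ (X n ∩ X m)}).Finite := by
        apply Set.Finite.biUnion F.finite_toSet
        intro n hn
        exact hcon n (hFS n hn)
      obtain ⟨m, ⟨hmS, hm1⟩, hm2⟩ :=
        ((hS.sdiff hfin).sdiff (Finset.range (F.sup id + 1)).finite_toSet).nonempty
      have hlt : ∀ n ∈ F, n < m := by
        intro n hn
        have : n ≤ F.sup id := Finset.le_sup (f := id) hn
        simp at hm2
        omega
      have hsm : ∀ n ∈ F, μ (X n ∩ X m) ≤ δ' := by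
        intro n hn
        by_contra! hc
        apply hm1
        simp only [Set.mem_iUnion]
        exact ⟨n, hn, hmS, hlt n hn, hc.le⟩
      have hsub : ∀ G : Finset ℕ, G ⊆ F → μ ((⋃ i ∈ G, X i) ∩ X m) ≤ G.card * δ' := by
        intro G
        induction G using Finset.induction_on with
        | empty => intro _; simp [h.empty]
        | insert n G hn ihG =>
          intro hG
          have h1 := ihG ((Finset.subset_insert _ _).trans hG)
          have h2 := hsm n (hG (Finset.mem_insert_self _ _))
          have h3 := h.union (X n ∩ X m) ((⋃ i ∈ G, X i) ∩ X m)
          have h4 : 0 ≤ μ ((X n ∩ X m) ∩ ((⋃ i ∈ G, X i) ∩ X m)) := by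
            rw [← h.empty]; exact h.mono (Set.empty_subset _)
          rw [← Set.union_inter_distrib_right] at h3
          rw [Finset.set_biUnion_insert, Finset.card_insert_of_notMem hn]
          push_cast
          linarith
      have hmF : m ∉ F := fun hc => lt_irrefl _ (hlt m hc)
      refine ⟨insert m F, by rw [Finset.card_insert_of_notMem hmF, hF], ?_, ?_⟩
      · rw [Finset.set_biUnion_insert]
        have h1 := hsub F subset_rfl
        have h2 := h.union (⋃ i ∈ F, X i) (X m)
        have h3 := hX m hmS
        rw [Set.union_comm] at h2
        rw [hF] at h1
        have : 0 ≤ δ' := by positivity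
        push_cast
        nlinarith
      · intro i hi
        rcases Finset.mem_insert.1 hi with rfl | hi
        · exact hmS
        · exact hFS i hi
  obtain ⟨F, _, hF, _⟩ := key K
  have h1 := h.le_one (⋃ i ∈ F, X i)
  have : (K:ℝ)^2 * δ' = 1 := by rw [hδ']; field_simp
  linarith

/-- The Bergelson intersection lemma for finitely additive means. -/
lemma MeanFor.bergelson (h : MeanFor a l U μ) (X : ℕ → Set ℕ)
    {δ : ℝ} (hδ : 0 < δ) (hX : ∀ n, δ ≤ μ (X n)) :
    ∃ φ : ℕ → ℕ, StrictMono φ ∧ ∀ k, 0 < μ (⋂ i ≤ k, X (φ i)) := by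
  let P : Set ℕ × ℕ × Set ℕ → Prop := fun s =>
    s.2.2.Infinite ∧ (∀ m ∈ s.2.2, s.2.1 < m) ∧
      ∃ δ > 0, ∀ m ∈ s.2.2, δ ≤ μ (s.1 ∩ X m)
  have hstep : ∀ s, P s → ∃ t, P t ∧ s.2.1 < t.2.1 ∧ t.1 = s.1 ∩ X t.2.1 := by
    rintro ⟨Y, n, S⟩ ⟨hS, hlt, δ, hδ, hm⟩
    obtain ⟨δ', hδ', n', hn', hinf⟩ := h.step (fun m => Y ∩ X m) hS hδ hm
    refine ⟨⟨Y ∩ X n', n', _⟩, ⟨hinf, ?_, δ', hδ', ?_⟩, hlt n' hn', rfl⟩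
    · intro m hm; exact hm.2.1
    · rintro m ⟨_, _, hm⟩
      refine hm.trans (h.mono ?_)
      rintro x ⟨hx, hx'⟩
      exact ⟨hx, hx'.2⟩
  choose! f hf1 hf2 hf3 using hstep
  have h0 : P ⟨Set.univ, 0, Set.Ioi 0⟩ :=
    ⟨Set.Ioi_infinite 0, fun m hm => hm, δ, hδ, fun m _ => by simpa using hX m⟩
  let s : ℕ → Set ℕ × ℕ × Set ℕ := fun k => Nat.rec ⟨Set.univ, 0, Set.Ioi 0⟩ (fun _ t => f t) k
  have hs : ∀ k, s (k+1) = f (s k) := fun k => rfl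
  have hP : ∀ k, P (s k) := by
    intro k
    induction k with
    | zero => exact h0
    | succ k ih => rw [hs]; exact hf1 _ ih
  refine ⟨fun k => (s (k+1)).2.1, strictMono_nat_of_lt_succ fun k => ?_, fun k => ?_⟩
  · have := hf2 _ (hP (k+1))
    rwa [← hs (k+1)] at this
  · have hsub : ∀ k, (s (k+1)).1 ⊆ ⋂ i ≤ k, X ((s (i+1)).2.1) := by
      intro k
      induction k with
      | zero =>
        have := hf3 _ (hP 0)
        rw [← hs] at this
        rw [this]
        intro x hx
        simpa using hx.2
      | succ k ih =>
        have := hf3 _ (hP (k+1))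
        rw [← hs (k+1)] at this
        rw [this]
        rintro x ⟨hx, hx'⟩
        have := ih hx
        simp only [Set.mem_iInter] at this ⊢
        intro i hi
        rcases Nat.lt_or_ge k i with h1 | h1
        · have : i = k + 1 := by omega
          subst this; exact hx'
        · exact this i h1
    obtain ⟨hi, _, δ, hδ, hm⟩ := hP (k+1)
    obtain ⟨m, hmm⟩ := hi.nonempty
    exact hδ.trans_le ((hm m hmm).trans (h.mono (Set.inter_subset_left.trans (hsub k))))

lemma MeanFor.good (h : MeanFor a l U μ) (hU : (U : Filter ℕ) ≤ atTop)
    (hl : ∀ n, n < l n) (A : Set ℕ) (α β : ℝ) (hα : α ≤ μ A) (hβ : 0 ≤ β) (b k : ℕ) (hk : 0 < k) :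
    α - β ≤ μ {c | β * k ≤ cntIco {x | x + c ∈ A} b k} := by
  classical
  set G : Set ℕ := {c | β * k ≤ cntIco {x | x + c ∈ A} b k} with hG
  have h1 : ∑ i ∈ Finset.Ico b (b + k), α ≤ ∑ i ∈ Finset.Ico b (b + k), μ {x | x + i ∈ A} :=
    Finset.sum_le_sum fun i _ => hα.trans (h.shift hU hl A i)
  have h2 : ∑ i ∈ Finset.Ico b (b + k), μ {x | x + i ∈ A} ≤ k * (β + μ G) := by
    refine le_of_tendsto_of_tendsto' (tendsto_finsetSum _ fun i _ => h.tend {x | x + i ∈ A})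
      (((h.tend G).const_add β).const_mul (k:ℝ)) fun n => ?_
    have hln : (0:ℝ) < l n := by exact_mod_cast (Nat.zero_le n).trans_lt (hl n)
    rw [← Finset.sum_div, div_le_iff₀ hln]
    have e : (k:ℝ) * (β + cntIco G (a n) (l n) / l n) * l n
        = k * (β * l n + cntIco G (a n) (l n)) := by field_simp
    rw [e]
    have e2 : ∑ i ∈ Finset.Ico b (b + k), (cntIco {x | x + i ∈ A} (a n) (l n) : ℝ)
        = ∑ c ∈ Finset.Ico (a n) (a n + l n), (cntIco {x | x + c ∈ A} b k : ℝ) := by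
      simp only [cntIco, Finset.card_filter, Set.mem_ofPred_eq]
      push_cast
      rw [Finset.sum_comm]
      refine Finset.sum_congr rfl fun c _ => Finset.sum_congr rfl fun i _ => ?_
      rw [add_comm]
    rw [e2]
    calc ∑ c ∈ Finset.Ico (a n) (a n + l n), (cntIco {x | x + c ∈ A} b k : ℝ)
        ≤ ∑ c ∈ Finset.Ico (a n) (a n + l n), (k * β + k * (if c ∈ G then 1 else 0)) := by
          refine Finset.sum_le_sum fun c _ => ?_
          split_ifs with hc
          · have : (cntIco {x | x + c ∈ A} b k : ℝ) ≤ k := by exact_mod_cast cntIco_le _ _ _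
            have : 0 ≤ (k:ℝ) * β := by positivity
            linarith
          · have : (cntIco {x | x + c ∈ A} b k : ℝ) < β * k := by
              simpa [hG] using hc
            linarith
      _ = k * (β * l n + cntIco G (a n) (l n)) := by
          rw [Finset.sum_add_distrib, ← Finset.mul_sum, ← Finset.mul_sum]
          rw [Finset.sum_boole]
          simp only [cntIco, Finset.sum_const, Nat.card_Ico, nsmul_eq_mul, Nat.add_sub_cancel_left]
          ring
  simp only [Finset.sum_const, Nat.card_Ico, nsmul_eq_mul] at h1
  have hk' : (0:ℝ) < k := by exact_mod_cast hk
  have h3 : ((b + k - b : ℕ) : ℝ) = k := by simp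
  rw [h3] at h1
  have := le_of_mul_le_mul_left (h1.trans h2) hk'
  linarith

end mean

lemma exists_intervals (A : Set ℕ) (hA : banachDensity A > 1 / 2) :
    ∃ α : ℝ, 1 / 2 < α ∧ ∃ a l : ℕ → ℕ, (∀ n, n < l n) ∧
      ∀ n, α * l n ≤ cntIco A (a n) (l n) := by
  classical
  obtain ⟨γ, hγ1, hγ2⟩ := exists_between hA
  obtain ⟨α, hα1, hα2⟩ := exists_between hγ1
  have hfr : ∃ᶠ n : ℕ in atTop, γ < ⨆ m : ℕ, (Nat.card ↥(A ∩ Set.Icc m (m + n)) : ℝ) / n := by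
    refine Filter.frequently_lt_of_lt_limsup ?_ hγ2
    refine Filter.IsCoboundedUnder.of_frequently_ge (a := 0) (Frequently.of_forall fun n => ?_)
    exact Real.iSup_nonneg fun m => by positivity
  have : ∀ k : ℕ, ∃ m n : ℕ, k < n ∧ α * n ≤ cntIco A m n := by
    intro k
    obtain ⟨N, hN⟩ := exists_nat_gt (1 / (γ - α))
    obtain ⟨n, hn, hlt⟩ := (frequently_atTop.1 hfr) (max (k+1) N)
    obtain ⟨m, hm⟩ := exists_lt_of_lt_ciSup hlt
    refine ⟨m, n, by have := le_max_left (k+1) N; omega, ?_⟩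
    have hn0 : (0:ℝ) < n := by
      have := le_max_left (k+1) N
      exact_mod_cast (by omega : 0 < n)
    rw [lt_div_iff₀ hn0] at hm
    have hc : Nat.card ↥(A ∩ Set.Icc m (m + n)) ≤ cntIco A m n + 1 := by
      have : A ∩ Set.Icc m (m + n) ⊆
          ((insert (m+n) ((Finset.Ico m (m + n)).filter (fun x => x ∈ A)) : Finset ℕ) : Set ℕ) := by
        rintro x ⟨hx, hx1, hx2⟩
        simp only [Finset.coe_insert, Finset.coe_filter, Finset.mem_Ico, Set.mem_insert_iff,
          Set.mem_ofPred_eq]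
        by_cases hh : x = m + n
        · exact Or.inl hh
        · exact Or.inr ⟨⟨hx1, by omega⟩, hx⟩
      have h2 := Set.ncard_le_ncard this (Finset.finite_toSet _)
      rw [Set.ncard_coe_finset] at h2
      exact h2.trans (Finset.card_insert_le _ _)
    have hc' : (Nat.card ↥(A ∩ Set.Icc m (m + n)) : ℝ) ≤ cntIco A m n + 1 := by exact_mod_cast hc
    have hNn : (N:ℝ) ≤ n := by exact_mod_cast (le_max_right (k+1) N).trans hn
    have h3 : 0 < γ - α := by linarith
    rw [div_lt_iff₀ h3] at hN
    nlinarith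
  choose a l h1 h2 using this
  exact ⟨α, hα1, a, l, h1, h2⟩

/-- The final interleaving construction. -/
lemma interleave (A L : Set ℕ) (d : ℕ → ℕ) (hd : StrictMono d)
    (hL : ∀ b ∈ L, ∀ᶠ i in atTop, b + d i ∈ A)
    (hinf : ∀ k, (⋂ i ≤ k, ({x | x + d i ∈ A} ∩ L)).Infinite) :
    ∃ B C : Set ℕ, B.Infinite ∧ C.Infinite ∧ ∀ b ∈ B, ∀ c ∈ C, b + c ∈ A := by
  have hT : ∀ b, ∃ T, b ∈ L → ∀ i ≥ T, b + d i ∈ A := by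
    intro b
    by_cases hb : b ∈ L
    · obtain ⟨T, hT⟩ := eventually_atTop.1 (hL b hb)
      exact ⟨T, fun _ => hT⟩
    · exact ⟨0, fun h => absurd h hb⟩
  choose T hT using hT
  have hp : ∀ k b, ∃ b', b < b' ∧ b' ∈ L ∧ ∀ i ≤ k, b' + d i ∈ A := by
    intro k b
    obtain ⟨b', hb', hlt⟩ := (hinf k).exists_gt b
    simp only [Set.mem_iInter, Set.mem_inter_iff, Set.mem_ofPred_eq] at hb'
    exact ⟨b', hlt, (hb' 0 (Nat.zero_le _)).2, fun i hi => (hb' i hi).1⟩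
  choose p hp1 hp2 hp3 using hp
  let s : ℕ → ℕ × ℕ := fun k => Nat.rec (p 0 0, 0)
    (fun _ t => (p (max (t.2 + 1) (T t.1)) t.1, max (t.2 + 1) (T t.1))) k
  have hs1 : ∀ k, (s (k+1)).1 = p (s (k+1)).2 (s k).1 := fun k => rfl
  have hs2 : ∀ k, (s (k+1)).2 = max ((s k).2 + 1) (T (s k).1) := fun k => rfl
  have hb : StrictMono fun k => (s k).1 := strictMono_nat_of_lt_succ fun k => by
    rw [hs1]; exact hp1 _ _
  have hN : StrictMono fun k => (s k).2 := strictMono_nat_of_lt_succ fun k => by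
    have := le_max_left ((s k).2 + 1) (T (s k).1)
    rw [hs2]; omega
  have hbL : ∀ k, (s k).1 ∈ L ∧ ∀ i ≤ (s k).2, (s k).1 + d i ∈ A := by
    intro k
    cases k with
    | zero => exact ⟨hp2 0 0, hp3 0 0⟩
    | succ k => rw [hs1]; exact ⟨hp2 _ _, hp3 _ _⟩
  refine ⟨Set.range fun k => (s k).1, Set.range fun k => d (s k).2,
    Set.infinite_range_of_injective hb.injective,
    Set.infinite_range_of_injective (hd.comp hN).injective, ?_⟩
  rintro _ ⟨k, rfl⟩ _ ⟨j, rfl⟩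
  rcases Nat.lt_or_ge k j with hkj | hkj
  · refine hT _ (hbL k).1 _ ?_
    have h1 : (s (k+1)).2 ≤ (s j).2 := hN.monotone hkj
    have h2 := le_max_right ((s k).2 + 1) (T (s k).1)
    rw [← hs2] at h2
    exact h2.trans h1
  · exact (hbL k).2 _ (hN.monotone hkj)

theorem sumset_of_banach_density_gt_half (A : Set ℕ)
    (hA : banachDensity A > 1 / 2) :
    ∃ B C : Set ℕ, B.Infinite ∧ C.Infinite ∧
      ∀ b ∈ B, ∀ c ∈ C, b + c ∈ A := by
  classical
  obtain ⟨α, hα, a, l, hl, hal⟩ := exists_intervals A hA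
  obtain ⟨β, hβ1, hβ2⟩ := exists_between hα
  have hU : ((hyperfilter ℕ : Ultrafilter ℕ) : Filter ℕ) ≤ atTop := by
    rw [← Nat.cofinite_eq_atTop]; exact hyperfilter_le_cofinite
  obtain ⟨μ, hμ⟩ := exists_mean a l (hyperfilter ℕ)
  obtain ⟨φ, hφ, hpos⟩ := hμ.bergelson
    (fun n => {c | β * l n ≤ cntIco {x | x + c ∈ A} (a n) (l n)}) (sub_pos.2 hβ2)
    (fun n => hμ.good hU hl A α β (hμ.ge hl hal) (by linarith) (a n) (l n)
      ((Nat.zero_le n).trans_lt (hl n)))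
  have hc : ∃ c : ℕ → ℕ, StrictMono c ∧ ∀ k, ∀ j ≤ k,
      β * l (φ j) ≤ cntIco {x | x + c k ∈ A} (a (φ j)) (l (φ j)) := by
    have hp : ∀ k b : ℕ, ∃ c, b < c ∧ ∀ j ≤ k,
        β * l (φ j) ≤ cntIco {x | x + c ∈ A} (a (φ j)) (l (φ j)) := by
      intro k b
      obtain ⟨c, hc, hlt⟩ := (hμ.infinite hU hl (hpos k)).exists_gt b
      simp only [Set.mem_iInter, Set.mem_ofPred_eq] at hc
      exact ⟨c, hlt, hc⟩
    choose p hp1 hp2 using hp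
    let s : ℕ → ℕ := fun k => Nat.rec (p 0 0) (fun k t => p (k+1) t) k
    have hs : ∀ k, s (k+1) = p (k+1) (s k) := fun k => rfl
    refine ⟨s, strictMono_nat_of_lt_succ fun k => by rw [hs]; exact hp1 _ _, fun k => ?_⟩
    cases k with
    | zero => exact hp2 0 0
    | succ k => rw [hs]; exact hp2 _ _
  obtain ⟨c, hcm, hc⟩ := hc
  obtain ⟨χ, θ, hθ, hlim⟩ := CompactSpace.tendsto_subseq
    (fun k : ℕ => (fun x : ℕ => decide (x + c k ∈ A)))
  rw [tendsto_pi_nhds] at hlim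
  let L : Set ℕ := {x | χ x = true}
  have hL : ∀ x, ∀ᶠ k in atTop, (x + c (θ k) ∈ A ↔ x ∈ L) := by
    intro x
    have := hlim x
    rw [nhds_discrete, tendsto_pure] at this
    filter_upwards [this] with k hk
    simp only [Function.comp] at hk
    change _ ↔ χ x = true
    rw [← hk]; simp
  have hLd : ∀ j, β * l (φ j) ≤ cntIco L (a (φ j)) (l (φ j)) := by
    intro j
    have h1 : ∀ᶠ k in atTop, ∀ x ∈ Finset.Ico (a (φ j)) (a (φ j) + l (φ j)),
        (x + c (θ k) ∈ A ↔ x ∈ L) := (Finset.eventually_all _).2 fun x _ => hL x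
    obtain ⟨k, hk, hjk⟩ := (h1.and (eventually_ge_atTop j)).exists
    have h2 := hc (θ k) j (hjk.trans (hθ.id_le k))
    have h3 : cntIco {x | x + c (θ k) ∈ A} (a (φ j)) (l (φ j)) = cntIco L (a (φ j)) (l (φ j)) := by
      unfold cntIco
      congr 1
      ext x
      simp only [Finset.mem_filter]
      exact and_congr_right fun hx => hk x hx
    rwa [h3] at h2
  have hl' : ∀ n, n < l (φ n) := fun n => (hφ.id_le n).trans_lt (hl _)
  obtain ⟨ν, hν⟩ := exists_mean (a ∘ φ) (l ∘ φ) (hyperfilter ℕ)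
  have hνL : β ≤ ν L := hν.ge hl' hLd
  have hνA : α ≤ ν A := hν.ge hl' fun n => hal (φ n)
  obtain ⟨ψ, hψ, hpos'⟩ := hν.bergelson (fun k => {x | x + c (θ k) ∈ A} ∩ L)
    (δ := α + β - 1) (by linarith) (fun k => by
      have h1 := hν.shift hU hl' A (c (θ k))
      have h2 := hν.union {x | x + c (θ k) ∈ A} L
      have h3 := hν.le_one ({x | x + c (θ k) ∈ A} ∪ L)
      linarith)
  refine interleave A L (fun i => c (θ (ψ i))) (hcm.comp (hθ.comp hψ)) ?_
    (fun k => hν.infinite hU hl' (hpos' k))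
  intro b hb
  filter_upwards [hψ.tendsto_atTop.eventually (hL b)] with i hi
  exact hi.2 hb
end

section
/- Let A ⊆ ℕ satisfy BD(A) > 1/2. Then there exist infinite sets B, C ⊆ ℕ with C ⊆ A such that B + C ⊆ A. -/
open Filter

/-- A finitely additive mean obtained as an ultrafilter limit of uniform averages. -/
lemma aux_mean (U : ℕ → Finset ℕ) :
    ∃ μ : Set ℕ → ℝ, (∀ E, 0 ≤ μ E) ∧ (∀ E, μ E ≤ 1) ∧ μ ∅ = 0 ∧
      (∀ E F, μ (E ∪ F) + μ (E ∩ F) = μ E + μ F) ∧ (∀ E F, E ⊆ F → μ E ≤ μ F) ∧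
      (∀ E ε, (∀ᶠ N in atTop, ε ≤ ((U N : Set ℕ) ∩ E).ncard / ((U N).card : ℝ)) → ε ≤ μ E) := by
  set r : Set ℕ → ℕ → ℝ := fun E N => ((U N : Set ℕ) ∩ E).ncard / ((U N).card : ℝ) with hr
  have hfin : ∀ E N, ((U N : Set ℕ) ∩ E).Finite := fun E N =>
    (U N).finite_toSet.subset Set.inter_subset_left
  have h0 : ∀ E N, 0 ≤ r E N := fun E N => by simp only [hr]; positivity
  have h1 : ∀ E N, r E N ≤ 1 := fun E N => by
    simp only [hr]
    apply div_le_one_of_le₀ _ (by positivity)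
    have := Set.ncard_le_ncard (Set.inter_subset_left : (U N : Set ℕ) ∩ E ⊆ U N)
      (U N).finite_toSet
    rw [Set.ncard_coe_finset] at this
    exact_mod_cast this
  have hex : ∀ E, ∃ x ∈ Set.Icc (0:ℝ) 1, Tendsto (r E) (hyperfilter ℕ : Filter ℕ) (nhds x) := by
    intro E
    have := (isCompact_Icc (a := (0:ℝ)) (b := 1)).ultrafilter_le_nhds
      ((hyperfilter ℕ).map (r E)) (by
        simp only [Ultrafilter.coe_map, le_principal_iff, mem_map]
        exact univ_mem' fun N => ⟨h0 E N, h1 E N⟩)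
    exact this
  choose μ hμ hlim using hex
  refine ⟨μ, fun E => (hμ E).1, fun E => (hμ E).2, ?_, ?_, ?_, ?_⟩
  · refine tendsto_nhds_unique (hlim ∅) ?_
    have : r ∅ = fun _ => 0 := by funext N; simp [hr]
    rw [this]; exact tendsto_const_nhds
  · intro E F
    refine tendsto_nhds_unique ((hlim (E ∪ F)).add (hlim (E ∩ F))) ?_
    have : (fun N => r (E ∪ F) N + r (E ∩ F) N) = fun N => r E N + r F N := by
      funext N
      simp only [hr, ← add_div]
      congr 1
      have := Set.ncard_union_add_ncard_inter ((U N : Set ℕ) ∩ E) ((U N : Set ℕ) ∩ F)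
        (hfin E N) (hfin F N)
      rw [← Set.inter_union_distrib_left, ← Set.inter_inter_distrib_left] at this
      exact_mod_cast this
    rw [this]
    exact (hlim E).add (hlim F)
  · intro E F hEF
    refine le_of_tendsto_of_tendsto' (hlim E) (hlim F) fun N => ?_
    simp only [hr]
    gcongr
    exact hfin F N
  · intro E ε h
    refine ge_of_tendsto (hlim E) ?_
    have hle : (hyperfilter ℕ : Filter ℕ) ≤ atTop := by
      rw [← Nat.cofinite_eq_atTop]; exact hyperfilter_le_cofinite
    exact hle h

/-- Bergelson's intersection lemma, finitely additive form. -/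
lemma aux_bergelson (U : ℕ → Finset ℕ) (hU : ∀ N, (U N).Nonempty) (E : ℕ → Set ℕ) (ε : ℝ)
    (hε : 0 < ε)
    (h : ∀ i, ∀ᶠ N in atTop, ε * (U N).card ≤ (((U N : Set ℕ) ∩ E i).ncard : ℝ)) :
    ∃ i : ℕ → ℕ, StrictMono i ∧ ∀ k, ∃ b, ∀ j ≤ k, b ∈ E (i j) := by
  obtain ⟨μ, h0, h1, hemp, hadd, hmono, hlow⟩ := aux_mean U
  have hE : ∀ i, ε ≤ μ (E i) := by
    intro i
    apply hlow
    filter_upwards [h i] with N hN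
    have : (0:ℝ) < (U N).card := by exact_mod_cast (hU N).card_pos
    rwa [le_div_iff₀ this]
  let P : Set ℕ → Prop := fun D => ∃ e > 0, ∃ᶠ i in atTop, e ≤ μ (D ∩ E i)
  have step : ∀ D, P D → ∀ n, ∃ i, n < i ∧ P (D ∩ E i) := by
    rintro D ⟨e, he, hf⟩ n
    by_contra! hcon
    have hsmall : ∀ i > n, ∀ η > 0, ∀ᶠ j in atTop, μ ((D ∩ E i) ∩ E j) < η := by
      intro i hi η hη
      by_contra hc
      apply hcon i hi
      refine ⟨η, hη, ?_⟩
      simpa [Filter.Frequently, not_le] using hc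
    have build : ∀ k : ℕ, ∃ V : Set ℕ, (k : ℝ) * (e / 2) ≤ μ V ∧
        ∀ η > 0, ∀ᶠ j in atTop, μ (V ∩ (D ∩ E j)) < η := by
      intro k
      induction k with
      | zero =>
        refine ⟨∅, by simp [hemp], fun η hη => ?_⟩
        simp [hemp, hη]
      | succ k ih =>
        obtain ⟨V, hV, hVs⟩ := ih
        obtain ⟨j, hj1, hj2, hj3⟩ :=
          (hf.and_eventually ((hVs (e / 2) (by positivity)).and (eventually_gt_atTop n))).exists
        refine ⟨V ∪ (D ∩ E j), ?_, fun η hη => ?_⟩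
        · have := hadd V (D ∩ E j)
          push_cast
          linarith
        · filter_upwards [hVs (η / 2) (by positivity), hsmall j hj3 (η / 2) (by positivity)]
            with l hl1 hl2
          have a1 := hadd (V ∩ (D ∩ E l)) ((D ∩ E j) ∩ E l)
          have a2 := h0 ((V ∩ (D ∩ E l)) ∩ ((D ∩ E j) ∩ E l))
          have a3 : μ ((V ∪ (D ∩ E j)) ∩ (D ∩ E l)) ≤
              μ ((V ∩ (D ∩ E l)) ∪ ((D ∩ E j) ∩ E l)) := by
            apply hmono
            rintro x ⟨hx | hx, hx2⟩
            · exact Or.inl ⟨hx, hx2⟩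
            · exact Or.inr ⟨hx, hx2.2⟩
          linarith
    obtain ⟨k, hk⟩ := exists_nat_gt (1 / (e / 2))
    obtain ⟨V, hV, -⟩ := build k
    have := h1 V
    rw [div_lt_iff₀ (by positivity)] at hk
    linarith
  have hPuniv : P Set.univ := ⟨ε, hε, by
    apply Filter.Eventually.frequently
    exact Eventually.of_forall fun i => by simpa using hE i⟩
  have hPne : ∀ D, P D → D.Nonempty := by
    rintro D ⟨e, he, hf⟩
    obtain ⟨i, hi⟩ := hf.exists
    by_contra hD
    rw [Set.not_nonempty_iff_eq_empty] at hD
    subst hD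
    simp [hemp] at hi
    linarith
  choose! g hg1 hg2 using step
  let f : ℕ → {p : Set ℕ × ℕ // P p.1} := fun k => Nat.rec ⟨(Set.univ, 0), hPuniv⟩
    (fun _ p => ⟨(p.1.1 ∩ E (g p.1.1 p.1.2), g p.1.1 p.1.2), hg2 _ p.2 _⟩) k
  have hf1 : ∀ k, (f (k+1)).1.1 = (f k).1.1 ∩ E (f (k+1)).1.2 := fun k => rfl
  have hf2 : ∀ k, (f k).1.2 < (f (k+1)).1.2 := fun k => hg1 _ (f k).2 _
  have hanti : Antitone fun k => (f k).1.1 := antitone_nat_of_succ_le fun k => by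
    rw [hf1]; exact Set.inter_subset_left
  refine ⟨fun k => (f (k+1)).1.2, strictMono_nat_of_lt_succ fun k => hf2 (k+1), fun k => ?_⟩
  obtain ⟨b, hb⟩ := hPne _ (f (k+1)).2
  refine ⟨b, fun j hj => ?_⟩
  have : b ∈ (f (j+1)).1.1 := hanti (by omega : j + 1 ≤ k + 1) hb
  rw [hf1] at this
  exact this.2

lemma aux_ncard (s : Finset ℕ) (p : Set ℕ) [DecidablePred (· ∈ p)] :
    ((s : Set ℕ) ∩ p).ncard = (s.filter (· ∈ p)).card := by
  rw [← Set.ncard_coe_finset]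
  congr 1
  ext x
  simp

open Classical in
/-- Shifting an interval by `x` loses at most `x` elements. -/
lemma aux_shift (A : Set ℕ) (m n x : ℕ) :
    ((Finset.Ico m (m+n)).filter (· ∈ A)).card ≤
      ((Finset.Ico m (m+n)).filter (fun c => x + c ∈ A)).card + x := by
  have hsub : (Finset.Ico m (m+n)).filter (· ∈ A) ⊆
      (((Finset.Ico m (m+n)).filter (fun c => x + c ∈ A)).image (fun c => x + c)) ∪
        Finset.Ico m (m + x) := by
    intro y hy
    simp only [Finset.mem_filter, Finset.mem_Ico, Finset.mem_union, Finset.mem_image] at hy ⊢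
    by_cases hxy : y < m + x
    · right; omega
    · left
      refine ⟨y - x, ⟨by omega, ?_⟩, by omega⟩
      rw [show x + (y - x) = y by omega]; exact hy.2
  refine (Finset.card_le_card hsub).trans ((Finset.card_union_le _ _).trans ?_)
  apply add_le_add
  · exact Finset.card_image_le
  · simp

lemma aux_density (A : Set ℕ) (hA : banachDensity A > 1 / 2) :
    ∃ δ > (0:ℝ), ∃ᶠ n in atTop, ∃ m : ℕ,
      (1/2 + δ) * n ≤ (((Set.Ico m (m+n)) ∩ A).ncard : ℝ) := by
  obtain ⟨c, hc1, hc2⟩ := exists_between hA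
  refine ⟨(c - 1/2)/2, by linarith, ?_⟩
  have hfr := Filter.frequently_lt_of_lt_limsup (by
    apply Filter.IsCoboundedUnder.of_frequently_ge (a := (0:ℝ))
    apply Filter.Eventually.frequently
    refine Eventually.of_forall fun n => Real.iSup_nonneg fun m => by positivity) hc2
  obtain ⟨K, hK⟩ := exists_nat_gt (2 / (c - 1/2))
  refine (hfr.and_eventually (eventually_ge_atTop (K+1))).mono ?_
  rintro n ⟨hn, hnK⟩
  obtain ⟨m, hm⟩ := exists_lt_of_lt_ciSup hn
  refine ⟨m, ?_⟩
  have hnpos : (0:ℝ) < n := by exact_mod_cast (by omega : 0 < n)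
  rw [lt_div_iff₀ hnpos] at hm
  have hcard : Nat.card ↥(A ∩ Set.Icc m (m + n)) ≤ ((Set.Ico m (m+n)) ∩ A).ncard + 1 := by
    rw [Nat.card_coe_set_eq]
    have hsub : A ∩ Set.Icc m (m + n) ⊆ insert (m+n) ((Set.Ico m (m+n)) ∩ A) := by
      rintro y ⟨hy, hy1, hy2⟩
      rcases hy2.lt_or_eq with h | h
      · exact Or.inr ⟨⟨hy1, h⟩, hy⟩
      · exact Or.inl h
    refine (Set.ncard_le_ncard hsub ?_).trans (Set.ncard_insert_le _ _)
    exact ((Set.finite_Ico _ _).inter_of_left _).insert _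
  have hcard' : (Nat.card ↥(A ∩ Set.Icc m (m + n)) : ℝ) ≤ ((Set.Ico m (m+n)) ∩ A).ncard + 1 := by
    exact_mod_cast hcard
  have hK2 : 2 / (c - 1/2) < n := hK.trans_le (by exact_mod_cast (by omega : K ≤ n))
  rw [div_lt_iff₀ (by linarith)] at hK2
  nlinarith

open Classical in
lemma aux_L (A : Set ℕ) (m n : ℕ → ℕ) (hn : ∀ k, k < n k) (δ : ℝ) (hδ : 0 < δ)
    (hd : ∀ k, (1/2 + δ) * n k ≤
      (((Finset.Ico (m k) (m k + n k)).filter (· ∈ A)).card : ℝ)) :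
    ∃ (L : Set ℕ) (d i : ℕ → ℕ), (∀ r, r ≤ d r) ∧ StrictMono i ∧
      (∀ r, ∀ x ≤ r, x ∈ L → x + d r ∈ A) ∧
      ∀ j, (1/2 + δ/2) * n (i j) ≤
        (((Finset.Ico (m (i j)) (m (i j) + n (i j))).filter (· ∈ L)).card : ℝ) := by
  let I : ℕ → Finset ℕ := fun k => Finset.Ico (m k) (m k + n k)
  let G : ℕ → Set ℕ := fun j =>
    {c | (1/2 + δ/2) * n j ≤ (((I j).filter (fun x => x + c ∈ A)).card : ℝ)}
  let E : ℕ → Set ℕ := fun j => {c | j ≤ c ∧ c ∈ G j}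
  have hIc : ∀ k, (I k).card = n k := fun k => by simp [I]
  obtain ⟨i, hi, hb⟩ := aux_bergelson I (fun N => by
      rw [← Finset.card_pos, hIc]; have := hn N; omega) E (δ/4) (by positivity) (by
    intro j
    obtain ⟨K, hK⟩ := exists_nat_gt (4 * (m j + n j + j) / δ)
    filter_upwards [eventually_ge_atTop K] with N hN
    have hnN : 4 * (m j + n j + j) / δ < n N :=
      hK.trans_le (by exact_mod_cast hN.trans (hn N).le)
    rw [div_lt_iff₀ hδ] at hnN
    rw [hIc, aux_ncard]
    -- double counting
    have hdc : ∑ c ∈ I N, (((I j).filter (fun x => x + c ∈ A)).card : ℝ) =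
        ∑ x ∈ I j, (((I N).filter (fun c => x + c ∈ A)).card : ℝ) := by
      have := Finset.sum_card_bipartiteAbove_eq_sum_card_bipartiteBelow
        (s := I N) (t := I j) (fun c x => x + c ∈ A)
      simp only [Finset.bipartiteAbove, Finset.bipartiteBelow] at this
      exact_mod_cast this
    have hlow : (n j : ℝ) * ((1/2 + δ) * n N - (m j + n j)) ≤
        ∑ x ∈ I j, (((I N).filter (fun c => x + c ∈ A)).card : ℝ) := by
      rw [← hIc j, ← nsmul_eq_mul]
      apply Finset.card_nsmul_le_sum
      intro x hx
      have h1 := hd N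
      have h2 := aux_shift A (m N) (n N) x
      have h2' : (((Finset.Ico (m N) (m N + n N)).filter (· ∈ A)).card : ℝ) ≤
        ((I N).filter (fun c => x + c ∈ A)).card + x := by exact_mod_cast h2
      have h3 : (x : ℝ) ≤ m j + n j := by
        simp only [I, Finset.mem_Ico] at hx
        exact_mod_cast hx.2.le
      rw [hIc j]
      linarith
    have hup : ∑ c ∈ I N, (((I j).filter (fun x => x + c ∈ A)).card : ℝ) ≤
        n j * ((I N).filter (· ∈ G j)).card + (1/2 + δ/2) * n j * n N := by
      calc _ ≤ ∑ c ∈ I N, ((if c ∈ G j then (n j : ℝ) else 0) + (1/2 + δ/2) * n j) := by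
            apply Finset.sum_le_sum
            intro c _
            split_ifs with hc
            · have : ((I j).filter (fun x => x + c ∈ A)).card ≤ n j := by
                rw [← hIc j]; exact Finset.card_filter_le _ _
              have : (((I j).filter (fun x => x + c ∈ A)).card : ℝ) ≤ n j := by exact_mod_cast this
              have : 0 ≤ (1/2 + δ/2) * n j := by positivity
              linarith
            · simp only [G, Set.mem_ofPred_eq, not_le] at hc
              linarith
        _ = _ := by
            rw [Finset.sum_add_distrib, ← Finset.sum_filter, Finset.sum_const, Finset.sum_const,
              hIc, nsmul_eq_mul, nsmul_eq_mul]
            ring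
    have hnj : (0:ℝ) < n j := by exact_mod_cast (by have := hn j; omega : 0 < n j)
    have hG : (δ/2) * n N - (m j + n j) ≤ ((I N).filter (· ∈ G j)).card := by
      have : (n j : ℝ) * ((δ/2) * n N - (m j + n j)) ≤ n j * ((I N).filter (· ∈ G j)).card := by
        nlinarith
      exact le_of_mul_le_mul_left this hnj
    have hGE : ((I N).filter (· ∈ G j)).card ≤ ((I N).filter (· ∈ E j)).card + j := by
      have hsub : (I N).filter (· ∈ G j) ⊆ (I N).filter (· ∈ E j) ∪ Finset.range j := by
        intro c hc
        simp only [Finset.mem_filter, Finset.mem_union, Finset.mem_range] at hc ⊢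
        by_cases hcj : c < j
        · exact Or.inr hcj
        · exact Or.inl ⟨hc.1, not_lt.mp hcj, hc.2⟩
      have := (Finset.card_le_card hsub).trans (Finset.card_union_le _ _)
      simpa using this
    have hGE' : (((I N).filter (· ∈ G j)).card : ℝ) ≤ ((I N).filter (· ∈ E j)).card + j := by
      exact_mod_cast hGE
    linarith)
  choose c hc using hb
  let L : Set ℕ := {x | ∀ᶠ k in (hyperfilter ℕ : Filter ℕ), x + c k ∈ A}
  have hle : (hyperfilter ℕ : Filter ℕ) ≤ atTop := by
    rw [← Nat.cofinite_eq_atTop]; exact hyperfilter_le_cofinite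
  have key : ∀ r, ∃ k, r ≤ k ∧ ∀ x ≤ r, (x ∈ L ↔ x + c k ∈ A) := by
    intro r
    have h1 : ∀ x ∈ Set.Iic r, ∀ᶠ k in (hyperfilter ℕ : Filter ℕ), (x ∈ L ↔ x + c k ∈ A) := by
      intro x _
      by_cases hx : x ∈ L
      · have hx' := hx
        simp only [L, Set.mem_ofPred_eq] at hx'
        filter_upwards [hx'] with k hk
        simp [hx, hk]
      · have hx' := hx
        simp only [L, Set.mem_ofPred_eq] at hx'
        rw [← Ultrafilter.eventually_not] at hx'
        filter_upwards [hx'] with k hk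
        simp [hx, hk]
    have h2 := (Filter.eventually_all_finite (Set.finite_Iic r)).2 h1
    obtain ⟨k, hk1, hk2⟩ := (h2.and (hle (eventually_ge_atTop r))).exists
    exact ⟨k, hk2, hk1⟩
  choose κ hκ1 hκ2 using key
  refine ⟨L, fun r => c (κ r), i, fun r => ?_, hi, fun r x hx hxL => (hκ2 r x hx).1 hxL, ?_⟩
  · have h1 := (hc (κ r) (κ r) le_rfl).1
    have h2 := hi.id_le (κ r)
    have h3 := hκ1 r
    simp only [id] at h2
    exact h3.trans (h2.trans h1)
  · intro j
    let r := max j (m (i j) + n (i j))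
    have h1 := (hc (κ r) j ((le_max_left _ _).trans (hκ1 r))).2
    simp only [G, Set.mem_ofPred_eq] at h1
    refine h1.trans (le_of_eq ?_)
    congr 2
    apply Finset.filter_congr
    intro x hx
    rw [hκ2 r x]
    simp only [I, Finset.mem_Ico] at hx
    exact hx.2.le.trans (le_max_right _ _)

open Classical in
lemma aux_sumset (A : Set ℕ) (hA : banachDensity A > 1 / 2) :
    ∃ b c : ℕ → ℕ, StrictMono b ∧ StrictMono c ∧ ∀ k l, b k + c l ∈ A := by
  obtain ⟨δ, hδ, hfr⟩ := aux_density A hA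
  have hsel : ∀ k, ∃ n m : ℕ, k < n ∧ (1/2 + δ) * n ≤
      (((Finset.Ico m (m + n)).filter (· ∈ A)).card : ℝ) := by
    intro k
    obtain ⟨n, ⟨m, hm⟩, hn⟩ := (hfr.and_eventually (eventually_gt_atTop k)).exists
    refine ⟨n, m, hn, ?_⟩
    rwa [← Finset.coe_Ico, aux_ncard] at hm
  choose n m hn hd using hsel
  obtain ⟨L, d, i, hdr, hi, hL, hLd⟩ := aux_L A m n hn δ hδ hd
  let I : ℕ → Finset ℕ := fun k => Finset.Ico (m (i k)) (m (i k) + n (i k))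
  have hIc : ∀ k, (I k).card = n (i k) := fun k => by simp [I]
  obtain ⟨s, hs, hb⟩ := aux_bergelson I (fun N => by
      rw [← Finset.card_pos, hIc]; have := hn (i N); omega)
      (fun r => {b | r ≤ b ∧ b ∈ L ∧ d r + b ∈ A}) δ hδ (by
    intro r
    obtain ⟨K, hK⟩ := exists_nat_gt (2 * (d r + r) / δ)
    filter_upwards [eventually_ge_atTop K] with N hN
    have hnN : 2 * (d r + r) / δ < n (i N) :=
      hK.trans_le (by exact_mod_cast (hN.trans (hi.id_le N)).trans (hn _).le)
    rw [div_lt_iff₀ hδ] at hnN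
    rw [hIc, aux_ncard]
    have h1 := hd (i N)
    have h2 := aux_shift A (m (i N)) (n (i N)) (d r)
    have h3 := hLd N
    have h4 : ((I N).filter (· ∈ L)).card + ((I N).filter (fun b => d r + b ∈ A)).card ≤
        n (i N) + (((I N).filter
          (· ∈ {b | r ≤ b ∧ b ∈ L ∧ d r + b ∈ A})).card + r) := by
      rw [← Finset.card_union_add_card_inter]
      apply add_le_add
      · rw [← hIc]
        exact Finset.card_le_card (Finset.union_subset (Finset.filter_subset _ _)
          (Finset.filter_subset _ _))
      · have hsub : (I N).filter (· ∈ L) ∩ (I N).filter (fun b => d r + b ∈ A) ⊆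
            (I N).filter (· ∈ {b | r ≤ b ∧ b ∈ L ∧ d r + b ∈ A}) ∪ Finset.range r := by
          intro b hb
          simp only [Finset.mem_filter, Finset.mem_union, Finset.mem_range, Finset.mem_inter,
            Set.mem_ofPred_eq] at hb ⊢
          by_cases hbr : b < r
          · exact Or.inr hbr
          · exact Or.inl ⟨hb.1.1, not_lt.mp hbr, hb.1.2, hb.2.2⟩
        have := (Finset.card_le_card hsub).trans (Finset.card_union_le _ _)
        simpa using this
    have h2' : (((Finset.Ico (m (i N)) (m (i N) + n (i N))).filter (· ∈ A)).card : ℝ) ≤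
      ((I N).filter (fun c => d r + c ∈ A)).card + d r := by exact_mod_cast h2
    have h4' : (((I N).filter (· ∈ L)).card : ℝ) + ((I N).filter (fun b => d r + b ∈ A)).card ≤
        n (i N) + (((I N).filter
          (· ∈ {b | r ≤ b ∧ b ∈ L ∧ d r + b ∈ A})).card + r) := by exact_mod_cast h4
    have h3' : (1/2 + δ/2) * n (i N) ≤ (((I N).filter (· ∈ L)).card : ℝ) := h3
    linarith)
  choose b hb using hb
  -- interleave
  let κ : ℕ → ℕ := fun t => Nat.rec 0 (fun _ k => b k + d (s k) + k + 1) t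
  have hκ : ∀ t, κ (t+1) = b (κ t) + d (s (κ t)) + κ t + 1 := fun t => rfl
  have hκm : StrictMono κ := strictMono_nat_of_lt_succ fun t => by rw [hκ]; omega
  have hsid : ∀ k, k ≤ s k := fun k => hs.id_le k
  refine ⟨fun t => b (κ t), fun t => d (s (κ t)), strictMono_nat_of_lt_succ fun t => ?_,
    strictMono_nat_of_lt_succ fun t => ?_, fun k l => ?_⟩
  · have h1 := (hb (κ (t+1)) (κ (t+1)) le_rfl).1
    have h2 := hsid (κ (t+1))
    have h3 := hκ t
    omega
  · have h1 := hdr (s (κ (t+1)))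
    have h2 := hsid (κ (t+1))
    have h3 := hκ t
    show d (s (κ t)) < d (s (κ (t+1)))
    omega
  · rcases le_or_gt l k with hlk | hlk
    · have := (hb (κ k) (κ l) (hκm.monotone hlk)).2.2
      rwa [add_comm] at this
    · apply hL _ _ _ (hb (κ k) (κ k) le_rfl).2.1
      have h1 : κ (k+1) ≤ κ l := hκm.monotone hlk
      have h2 := hsid (κ l)
      have h3 := hκ k
      omega

theorem sumset_of_banach_density_gt_half' (A : Set ℕ)
    (hA : banachDensity A > 1 / 2) :
    ∃ B C : Set ℕ, B.Infinite ∧ C.Infinite ∧ C ⊆ A ∧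
      ∀ b ∈ B, ∀ c ∈ C, b + c ∈ A := by
  obtain ⟨b, c, hb, hc, h⟩ := aux_sumset A hA
  have hb0 : ∀ k, b 0 ≤ b k := fun k => hb.monotone (Nat.zero_le k)
  refine ⟨Set.range fun k => b k - b 0, Set.range fun k => b 0 + c k,
    Set.infinite_range_of_injective fun k l hkl => hb.injective ?_,
    Set.infinite_range_of_injective fun k l hkl => hc.injective ?_, ?_, ?_⟩
  · have h1 := hb0 k
    have h2 := hb0 l
    replace hkl : b k - b 0 = b l - b 0 := hkl
    omega
  · replace hkl : b 0 + c k = b 0 + c l := hkl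
    omega
  · rintro _ ⟨k, rfl⟩
    exact h 0 k
  · rintro _ ⟨k, rfl⟩ _ ⟨l, rfl⟩
    have h1 := hb0 k
    have := h k l
    rwa [show b k - b 0 + (b 0 + c l) = b k + c l by omega]
end

section
/- Let A ⊆ ℕ satisfy BD(A) > 0. Then there exist infinite sets B, C ⊆ ℕ and an integer k ∈ ℤ such that B + C ⊆ A ∪ (A + k), where sums and the translate A + k are computed in ℤ. -/
open Filter Topology

namespace OneShift

noncomputable section

/-- Number of elements of `S` in `[m, m+n)`. -/
def cnt (S : Set ℕ) (m n : ℕ) : ℝ := ∑ i ∈ Finset.range n, S.indicator (fun _ => (1 : ℝ)) (m + i)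

lemma ind_nonneg (S : Set ℕ) (x : ℕ) : 0 ≤ S.indicator (fun _ => (1 : ℝ)) x :=
  Set.indicator_nonneg (fun _ _ => zero_le_one) x

lemma ind_le (S : Set ℕ) (x : ℕ) : S.indicator (fun _ => (1 : ℝ)) x ≤ 1 :=
  Set.indicator_le_self' (fun _ _ => zero_le_one) x

lemma cnt_nonneg (S : Set ℕ) (m n : ℕ) : 0 ≤ cnt S m n :=
  Finset.sum_nonneg fun _ _ => ind_nonneg S _

lemma cnt_le (S : Set ℕ) (m n : ℕ) : cnt S m n ≤ n := by
  calc cnt S m n ≤ ∑ i ∈ Finset.range n, (1 : ℝ) := Finset.sum_le_sum fun _ _ => ind_le S _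
    _ = n := by simp

lemma cnt_mono {S T : Set ℕ} (h : S ⊆ T) (m n : ℕ) : cnt S m n ≤ cnt T m n :=
  Finset.sum_le_sum fun _ _ => Set.indicator_le_indicator_of_subset h (fun _ => zero_le_one) _

lemma cnt_union (S T : Set ℕ) (m n : ℕ) :
    cnt (S ∪ T) m n + cnt (S ∩ T) m n = cnt S m n + cnt T m n := by
  unfold cnt
  rw [← Finset.sum_add_distrib, ← Finset.sum_add_distrib]
  refine Finset.sum_congr rfl fun i _ => ?_
  by_cases h1 : m + i ∈ S <;> by_cases h2 : m + i ∈ T <;> simp [h1, h2]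

lemma cnt_shift_one (S : Set ℕ) (m n : ℕ) : cnt S m n ≤ cnt S (m + 1) n + 1 := by
  have h1 := Finset.sum_range_succ (fun i => S.indicator (fun _ => (1 : ℝ)) (m + i)) n
  have h2 := Finset.sum_range_succ' (fun i => S.indicator (fun _ => (1 : ℝ)) (m + i)) n
  have h3 : cnt S (m + 1) n
      = ∑ i ∈ Finset.range n, S.indicator (fun _ => (1 : ℝ)) (m + (i + 1)) := by
    unfold cnt
    refine Finset.sum_congr rfl fun i _ => ?_
    congr 1; ring
  have h4 := ind_nonneg S (m + n)
  have h5 := ind_le S (m + 0)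
  rw [h3]
  unfold cnt
  linarith

lemma cnt_shift (S : Set ℕ) (m n j : ℕ) : cnt S m n ≤ cnt S (m + j) n + j := by
  induction j with
  | zero => simp
  | succ j ih =>
    have := cnt_shift_one S (m + j) n
    push_cast
    rw [← add_assoc m j 1]
    linarith

lemma cnt_trans (S : Set ℕ) (m n c : ℕ) : cnt {x | x + c ∈ S} m n = cnt S (m + c) n := by
  unfold cnt
  refine Finset.sum_congr rfl fun i _ => ?_
  have : m + c + i = m + i + c := by ring
  rw [this]
  by_cases h : m + i + c ∈ S <;> simp [h]

lemma cnt_double (S : Set ℕ) (x q r : ℕ) :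
    ∑ i ∈ Finset.range q, cnt S (x + i) r = ∑ j ∈ Finset.range r, cnt S (x + j) q := by
  unfold cnt
  rw [Finset.sum_comm]
  refine Finset.sum_congr rfl fun i _ => Finset.sum_congr rfl fun j _ => ?_
  congr 1; ring

lemma cnt_Iio (N m n : ℕ) : cnt (Set.Iio N) m n ≤ N := by
  have h := cnt_shift (Set.Iio N) m n N
  have h2 : cnt (Set.Iio N) (m + N) n = 0 := by
    unfold cnt
    refine Finset.sum_eq_zero fun i _ => ?_
    rw [Set.indicator_of_notMem]
    simp only [Set.mem_Iio]; omega
  linarith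

/-! Density -/

def Dense (S : Set ℕ) (δ : ℝ) : Prop := ∀ N : ℕ, ∃ m n : ℕ, N ≤ n ∧ δ * n ≤ cnt S m n

def fat (A : Set ℕ) (N : ℕ) : Set ℕ := {x | ∃ f < N, ∃ a ∈ A, x = a + f}

lemma dense_of_bd (A : Set ℕ) (hA : 0 < banachDensity A) : ∃ δ > 0, Dense A δ := by
  obtain ⟨δ, h0, h1⟩ := exists_between hA
  have hfr : ∃ᶠ n : ℕ in atTop,
      δ < ⨆ m : ℕ, (Nat.card ↥(A ∩ Set.Icc m (m + n)) : ℝ) / n := by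
    refine frequently_lt_of_lt_limsup ?_ h1
    refine isCoboundedUnder_le_of_le atTop (x := 0) fun n => ?_
    exact Real.iSup_nonneg fun m => by positivity
  refine ⟨δ / 2, by positivity, fun N => ?_⟩
  obtain ⟨n, hn, hlt⟩ := frequently_atTop.1 hfr (N + 1)
  obtain ⟨m, hm⟩ := exists_lt_of_lt_ciSup hlt
  have hn0 : (1 : ℝ) ≤ n := by exact_mod_cast (by omega : 1 ≤ n)
  rw [lt_div_iff₀ (by linarith)] at hm
  have hc : (Nat.card ↥(A ∩ Set.Icc m (m + n)) : ℝ) ≤ cnt A m (n + 1) := by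
    classical
    have e : cnt A m (n + 1)
        = (((Finset.range (n + 1)).filter (fun i => m + i ∈ A)).card : ℝ) := by
      unfold cnt
      rw [Finset.card_filter]
      push_cast
      refine Finset.sum_congr rfl fun i _ => ?_
      by_cases h : m + i ∈ A <;> simp [h]
    rw [e]
    norm_cast
    have : A ∩ Set.Icc m (m + n)
        ⊆ ((((Finset.range (n + 1)).filter (fun i => m + i ∈ A)).image (fun i => m + i) :
            Finset ℕ) : Set ℕ) := by
      rintro x ⟨hx, hx1, hx2⟩
      simp only [Finset.coe_image, Set.mem_image, Finset.coe_filter, Finset.mem_range,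
        Set.mem_ofPred_eq]
      exact ⟨x - m, ⟨by omega, by rwa [Nat.add_sub_cancel' hx1]⟩, by omega⟩
    calc Nat.card ↥(A ∩ Set.Icc m (m + n)) ≤ _ := Nat.card_mono (Finset.finite_toSet _) this
      _ ≤ _ := by
        rw [Nat.card_coe_set_eq, Set.ncard_coe_finset]
        exact Finset.card_image_le
  refine ⟨m, n + 1, by omega, ?_⟩
  push_cast
  nlinarith

lemma fat_fat {A : Set ℕ} {n N x y : ℕ} (hx : x ∈ fat A n) (h1 : x ≤ y) (h2 : y ≤ x + N) :
    y ∈ fat A (n + N) := by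
  obtain ⟨f, hf, a, ha, rfl⟩ := hx
  exact ⟨y - a, by omega, a, ha, by omega⟩

lemma hindman_aux (A : Set ℕ) (n : ℕ) (δ δ' : ℝ) (hδ' : 0 < δ') (hlt : δ' * δ' < δ)
    (hd : Dense (fat A n) δ) (hn : ∀ m, ¬ Dense (fat A m) δ') : False := by
  have h1 := hn n
  unfold Dense at h1
  push Not at h1
  obtain ⟨N, hN⟩ := h1
  have h2 := hn (n + (N + 1))
  unfold Dense at h2
  push Not at h2
  obtain ⟨M, hM⟩ := h2
  set K := N + 1 with hK
  have hKpos : (0 : ℝ) < K := by positivity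
  obtain ⟨Q, hQ⟩ := exists_nat_gt ((K : ℝ) / (δ - δ' * δ'))
  obtain ⟨m, r, hr, hmr⟩ := hd (M + Q)
  have hrQ : (Q : ℝ) ≤ r := by exact_mod_cast (by omega : Q ≤ r)
  rw [div_lt_iff₀ (by linarith)] at hQ
  have hdc := cnt_double (fat A n) m r K
  have hlow : (K : ℝ) * (δ * r - K) ≤ ∑ j ∈ Finset.range K, cnt (fat A n) (m + j) r := by
    calc (K : ℝ) * (δ * r - K) = ∑ j ∈ Finset.range K, (δ * r - K) := by simp [mul_sub]
      _ ≤ _ := Finset.sum_le_sum fun j hj => by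
        have := cnt_shift (fat A n) m r j
        have hj' : (j : ℝ) ≤ K := by exact_mod_cast (Finset.mem_range.1 hj).le
        linarith
  have hup : ∑ i ∈ Finset.range r, cnt (fat A n) (m + i) K
      ≤ δ' * K * cnt (fat A (n + K)) (m + K) r := by
    unfold cnt
    rw [Finset.mul_sum]
    refine Finset.sum_le_sum fun i _ => ?_
    by_cases hx : m + K + i ∈ fat A (n + K)
    · simp only [hx, Set.indicator_of_mem, mul_one]
      exact (hN (m + i) K (by omega)).le
    · simp only [hx, not_false_eq_true, Set.indicator_of_notMem, mul_zero]
      refine le_of_eq (Finset.sum_eq_zero fun j hj => ?_)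
      rw [Set.indicator_of_notMem]
      intro hmem
      have := Finset.mem_range.1 hj
      exact hx (fat_fat hmem (by omega) (by omega))
  have h3 := (hM (m + K) r (by omega)).le
  have h4 : δ' * K * cnt (fat A (n + K)) (m + K) r ≤ δ' * K * (δ' * r) :=
    mul_le_mul_of_nonneg_left h3 (by positivity)
  have h5 : (K : ℝ) * (δ * r - K) ≤ K * (δ' * δ' * r) := by
    calc _ ≤ _ := hlow
      _ = _ := hdc.symm
      _ ≤ _ := hup
      _ ≤ _ := h4
      _ = _ := by ring
  have h6 := le_of_mul_le_mul_left h5 hKpos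
  nlinarith

lemma Dense.mono {S : Set ℕ} {δ ε : ℝ} (h : Dense S δ) (he : ε ≤ δ) : Dense S ε := by
  intro N
  obtain ⟨m, n, h1, h2⟩ := h N
  exact ⟨m, n, h1, le_trans (mul_le_mul_of_nonneg_right he (by positivity)) h2⟩

lemma hindman (A : Set ℕ) (δ : ℝ) (hδ : 0 < δ) (hA : Dense A δ) :
    ∃ N, Dense (fat A N) (2 / 3) := by
  by_contra hcon
  push Not at hcon
  set D : Set ℝ := {d | ∃ n, Dense (fat A n) d} with hD
  have hbdd : ∀ d ∈ D, d ≤ 2 / 3 := by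
    rintro d ⟨n, hd⟩
    by_contra hlt
    exact hcon n (hd.mono (not_le.1 hlt).le)
  have hmem : δ ∈ D := by
    refine ⟨1, ?_⟩
    have : fat A 1 = A := by
      ext x
      constructor
      · rintro ⟨f, hf, a, ha, rfl⟩
        obtain rfl : f = 0 := by omega
        exact ha
      · intro hx
        exact ⟨0, by omega, x, hx, rfl⟩
    rwa [this]
  have hb : BddAbove D := ⟨2 / 3, hbdd⟩
  set β := sSup D with hβ
  have hβ0 : δ ≤ β := le_csSup hb hmem
  have hβ1 : β ≤ 2 / 3 := csSup_le ⟨δ, hmem⟩ hbdd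
  have hlt : (β + β / 12) * (β + β / 12) < β - β / 12 := by nlinarith
  obtain ⟨d, ⟨n, hd⟩, hdlt⟩ := exists_lt_of_lt_csSup ⟨δ, hmem⟩ (show β - β / 12 < β by linarith)
  refine hindman_aux A n (β - β / 12) (β + β / 12) (by linarith) hlt (hd.mono hdlt.le) ?_
  intro m hm
  have := le_csSup hb (show β + β / 12 ∈ D from ⟨m, hm⟩)
  linarith

/-! Means -/

structure IsMean (μ : Set ℕ → ℝ) : Prop where
  nonneg : ∀ S, 0 ≤ μ S
  le_one : ∀ S, μ S ≤ 1
  mono : ∀ {S T}, S ⊆ T → μ S ≤ μ T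
  union : ∀ S T, μ (S ∪ T) + μ (S ∩ T) = μ S + μ T
  small : ∀ N, μ (Set.Iio N) = 0

lemma exists_mean (a l : ℕ → ℕ) (hl : ∀ n, 0 < l n) (ht : Tendsto l atTop atTop) :
    ∃ μ : Set ℕ → ℝ, IsMean μ ∧ ∀ S, Tendsto (fun n => cnt S (a n) (l n) / l n)
      (hyperfilter ℕ : Filter ℕ) (𝓝 (μ S)) := by
  have hlr : ∀ n, (0 : ℝ) < l n := fun n => by exact_mod_cast hl n
  have key : ∀ S : Set ℕ, ∃ x : ℝ, Tendsto (fun n => cnt S (a n) (l n) / l n)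
      (hyperfilter ℕ : Filter ℕ) (𝓝 x) := by
    intro S
    have hc := (isCompact_Icc (a := (0 : ℝ)) (b := 1)).ultrafilter_le_nhds
      ((hyperfilter ℕ).map (fun n => cnt S (a n) (l n) / l n)) (by
        rw [le_principal_iff]
        refine Filter.mem_map.2 (Filter.univ_mem' fun n => ?_)
        refine ⟨div_nonneg (cnt_nonneg _ _ _) (hlr n).le, ?_⟩
        rw [div_le_one (hlr n)]
        exact cnt_le _ _ _)
    obtain ⟨x, -, hx⟩ := hc
    exact ⟨x, hx⟩
  choose μ hμ using key
  refine ⟨μ, ⟨fun S => ?_, fun S => ?_, fun {S T} h => ?_, fun S T => ?_, fun N => ?_⟩, hμ⟩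
  · exact ge_of_tendsto' (hμ S) fun n => div_nonneg (cnt_nonneg _ _ _) (hlr n).le
  · refine le_of_tendsto' (hμ S) fun n => ?_
    rw [div_le_one (hlr n)]
    exact cnt_le _ _ _
  · exact le_of_tendsto_of_tendsto' (hμ S) (hμ T) fun n =>
      div_le_div_of_nonneg_right (cnt_mono h _ _) (hlr n).le
  · refine tendsto_nhds_unique ((hμ (S ∪ T)).add (hμ (S ∩ T))) ?_
    refine ((hμ S).add (hμ T)).congr fun n => ?_
    rw [← add_div, ← add_div, cnt_union]
  · have hle : (hyperfilter ℕ : Filter ℕ) ≤ atTop := by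
      rw [← Nat.cofinite_eq_atTop]; exact hyperfilter_le_cofinite
    have h0 : Tendsto (fun n => (N : ℝ) / l n) (hyperfilter ℕ : Filter ℕ) (𝓝 0) := by
      refine Tendsto.mono_left ?_ hle
      exact tendsto_const_nhds.div_atTop (tendsto_natCast_atTop_atTop.comp ht)
    refine le_antisymm ?_ ?_
    · exact le_of_tendsto_of_tendsto' (hμ _) h0 fun n =>
        div_le_div_of_nonneg_right (cnt_Iio _ _ _) (hlr n).le
    · exact ge_of_tendsto' (hμ _) fun n => div_nonneg (cnt_nonneg _ _ _) (hlr n).le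

lemma IsMean.union_le {μ : Set ℕ → ℝ} (h : IsMean μ) (S T : Set ℕ) : μ (S ∪ T) ≤ μ S + μ T := by
  have := h.union S T
  have := h.nonneg (S ∩ T)
  linarith

lemma IsMean.empty {μ : Set ℕ → ℝ} (h : IsMean μ) : μ ∅ = 0 := by
  have := h.small 0
  rwa [show Set.Iio 0 = (∅ : Set ℕ) by ext; simp] at this

lemma IsMean.exists_ge {μ : Set ℕ → ℝ} (h : IsMean μ) {E : Set ℕ} (hE : 0 < μ E) (N : ℕ) :
    ∃ x ∈ E, N ≤ x := by
  by_contra hcon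
  push Not at hcon
  have := h.mono (show E ⊆ Set.Iio N from fun x hx => hcon x hx)
  rw [h.small] at this
  linarith

lemma IsMean.biUnion {ι : Type*} {μ : Set ℕ → ℝ} (h : IsMean μ) (s : Finset ι) (X : ι → Set ℕ) :
    μ (⋃ i ∈ s, X i) ≤ ∑ i ∈ s, μ (X i) := by
  classical
  induction s using Finset.induction_on with
  | empty => simp [h.empty]
  | insert i s hi ih =>
    rw [Finset.sum_insert hi, Finset.set_biUnion_insert]
    have := h.union_le (X i) (⋃ i ∈ s, X i)
    linarith

def Good {ι : Type*} (μ : Set ℕ → ℝ) (p : Ultrafilter ι) (S : ι → Set ℕ) (E : Set ℕ) : Prop :=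
  ∃ η > 0, ∀ᶠ d in (p : Filter ι), η ≤ μ (E ∩ S d)

lemma Good.pos {ι : Type*} {μ : Set ℕ → ℝ} (h : IsMean μ) {p : Ultrafilter ι} {S : ι → Set ℕ}
    {E : Set ℕ} (hE : Good μ p S E) : 0 < μ E := by
  obtain ⟨η, h0, h1⟩ := hE
  obtain ⟨d, hd⟩ := h1.exists
  have := h.mono (show E ∩ S d ⊆ E from Set.inter_subset_left)
  linarith

lemma Good.step {ι : Type*} {μ : Set ℕ → ℝ} (h : IsMean μ) {p : Ultrafilter ι} {S : ι → Set ℕ}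
    {E : Set ℕ} (hE : Good μ p S E) : ∀ᶠ c in (p : Filter ι), Good μ p S (E ∩ S c) := by
  obtain ⟨η, h0, h1⟩ := hE
  by_contra hcon
  rw [← Ultrafilter.eventually_not] at hcon
  have hG : ∀ᶠ c in (p : Filter ι), ∀ η' > 0,
      ∀ᶠ d in (p : Filter ι), μ (E ∩ S c ∩ S d) < η' := by
    filter_upwards [hcon] with c hc η' hη'
    by_contra hcc
    rw [← Ultrafilter.eventually_not] at hcc
    exact hc ⟨η', hη', hcc.mono fun d hd => not_lt.1 hd⟩
  have main : ∀ K : ℕ, ∃ U : Set ℕ, K * (η / 2) ≤ μ U ∧ ∀ η' > 0,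
      ∀ᶠ d in (p : Filter ι), μ (U ∩ (E ∩ S d)) < η' := by
    intro K
    induction K with
    | zero =>
      refine ⟨∅, by simp [h.empty], fun η' hη' => Eventually.of_forall fun d => ?_⟩
      simpa [h.empty] using hη'
    | succ K ih =>
      obtain ⟨U, hU, hU'⟩ := ih
      obtain ⟨d, hd1, hd2, hd3⟩ := (h1.and ((hU' (η / 2) (by positivity)).and hG)).exists
      refine ⟨U ∪ (E ∩ S d), ?_, fun η' hη' => ?_⟩
      · have := h.union U (E ∩ S d)
        push_cast
        linarith
      · filter_upwards [hU' (η' / 2) (by positivity), hd3 (η' / 2) (by positivity)] with e he1 he2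
        have hsub : (U ∪ (E ∩ S d)) ∩ (E ∩ S e) ⊆ (U ∩ (E ∩ S e)) ∪ (E ∩ S d ∩ S e) := by
          rintro x ⟨hx | hx, hx'⟩
          · exact Or.inl ⟨hx, hx'⟩
          · exact Or.inr ⟨hx, hx'.2⟩
        have := h.mono hsub
        have := h.union_le (U ∩ (E ∩ S e)) (E ∩ S d ∩ S e)
        linarith
  obtain ⟨K, hK⟩ := exists_nat_gt (1 / (η / 2))
  obtain ⟨U, hU, -⟩ := main K
  rw [div_lt_iff₀ (by positivity)] at hK
  have := h.le_one U
  linarith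

lemma exists_seq_list {α : Type*} (P : List α → Prop) (R : α → α → Prop) (h0 : P [])
    (h : ∀ l, P l → ∃ a, P (a :: l) ∧ ∀ x ∈ l, R x a) :
    ∃ f : ℕ → α, (∀ n, ∃ l, P l ∧ ∀ i < n, f i ∈ l) ∧ ∀ i j, i < j → R (f i) (f j) := by
  choose g hg1 hg2 using h
  let s : ℕ → {l // P l} := fun n =>
    Nat.rec ⟨[], h0⟩ (fun _ t => ⟨g t.1 t.2 :: t.1, hg1 t.1 t.2⟩) n
  have hs : ∀ n, (s (n + 1)).1 = g (s n).1 (s n).2 :: (s n).1 := fun n => rfl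
  have hm : ∀ n, ∀ i < n, g (s i).1 (s i).2 ∈ (s n).1 := by
    intro n
    induction n with
    | zero => intro i hi; omega
    | succ n ih =>
      intro i hi
      rw [hs]
      rcases Nat.lt_succ_iff_lt_or_eq.1 hi with h | rfl
      · exact List.mem_cons_of_mem _ (ih i h)
      · exact List.mem_cons_self
  refine ⟨fun n => g (s n).1 (s n).2, fun n => ⟨(s n).1, (s n).2, hm n⟩, fun i j hij => ?_⟩
  exact hg2 _ _ _ (hm j i hij)

lemma hyper_ev {P : ℕ → Prop} (N : ℕ) (h : ∀ n, N ≤ n → P n) :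
    ∀ᶠ n in (hyperfilter ℕ : Filter ℕ), P n := by
  have hle : (hyperfilter ℕ : Filter ℕ) ≤ atTop := by
    rw [← Nat.cofinite_eq_atTop]; exact hyperfilter_le_cofinite
  exact hle (eventually_atTop.2 ⟨N, h⟩)

/-- The first half: a set `A` of density at least `2/3` has a limit of translates which is
dense along a sequence of intervals along which `A` itself is dense. -/
lemma first_half (A : Set ℕ) (hA : Dense A (2 / 3)) :
    ∃ (p : Ultrafilter ℕ) (ν : Set ℕ → ℝ), IsMean ν ∧ (p : Filter ℕ) ≤ atTop ∧
      (∀ c, 2 / 3 ≤ ν {x | x + c ∈ A}) ∧ 7 / 12 ≤ ν {b | ∀ᶠ c in (p : Filter ℕ), b + c ∈ A} := by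
  choose a l hal hd using fun n => hA (n + 1)
  have hl : ∀ n, 0 < l n := fun n => by have := hal n; omega
  have hlr : ∀ n, (0 : ℝ) < l n := fun n => by exact_mod_cast hl n
  have hlt : Tendsto l atTop atTop :=
    tendsto_atTop_mono (fun n => (by have := hal n; omega : n ≤ l n)) tendsto_id
  obtain ⟨μ, hμ, hμt⟩ := exists_mean a l hl hlt
  have hle : (hyperfilter ℕ : Filter ℕ) ≤ atTop := by
    rw [← Nat.cofinite_eq_atTop]; exact hyperfilter_le_cofinite
  set S : ℕ → Set ℕ := fun n => {c | 7 / 12 * (l n : ℝ) ≤ cnt A (a n + c) (l n)} with hS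
  have hSμ : ∀ n, 1 / 12 ≤ μ (S n) := by
    intro n
    have hb : ∀ m, 1 / 12 - ((a n + l n : ℕ) : ℝ) / l m ≤ cnt (S n) (a m) (l m) / l m := by
      intro m
      rw [le_div_iff₀ (hlr m), sub_mul, div_mul_cancel₀ _ (hlr m).ne']
      have hdc := cnt_double A (a n + a m) (l m) (l n)
      have hlow : (l n : ℝ) * (2 / 3 * l m - (a n + l n : ℕ))
          ≤ ∑ j ∈ Finset.range (l n), cnt A (a n + a m + j) (l m) := by
        calc (l n : ℝ) * (2 / 3 * l m - (a n + l n : ℕ))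
            = ∑ j ∈ Finset.range (l n), (2 / 3 * (l m : ℝ) - (a n + l n : ℕ)) := by
              rw [Finset.sum_const, Finset.card_range, nsmul_eq_mul]
          _ ≤ _ := Finset.sum_le_sum fun j hj => by
            have h1 := cnt_shift A (a m) (l m) (a n + j)
            have h2 := hd m
            have hj' : ((a n + j : ℕ) : ℝ) ≤ ((a n + l n : ℕ) : ℝ) := by
              exact_mod_cast (by have := Finset.mem_range.1 hj; omega)
            rw [show a n + a m + j = a m + (a n + j) by ring]
            linarith
      have hup : ∑ i ∈ Finset.range (l m), cnt A (a n + a m + i) (l n)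
          ≤ (l n : ℝ) * (7 / 12 * l m + cnt (S n) (a m) (l m)) := by
        calc _ ≤ ∑ i ∈ Finset.range (l m),
              (l n : ℝ) * (7 / 12 + (S n).indicator (fun _ => (1 : ℝ)) (a m + i)) := by
              refine Finset.sum_le_sum fun i _ => ?_
              have h1 := cnt_le A (a n + a m + i) (l n)
              have := hlr n
              by_cases hx : a m + i ∈ S n
              · simp only [hx, Set.indicator_of_mem]
                linarith
              · have hx' := hx
                simp only [hS, Set.mem_ofPred_eq, not_le, ← add_assoc] at hx'
                simp only [hx, not_false_eq_true, Set.indicator_of_notMem, add_zero]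
                linarith
          _ = _ := by
              rw [← Finset.mul_sum, Finset.sum_add_distrib]
              simp [cnt, mul_comm]
      have h5 := le_of_mul_le_mul_left ((hlow.trans hdc.symm.le).trans hup) (hlr n)
      linarith
    have h0 : Tendsto (fun m => 1 / 12 - ((a n + l n : ℕ) : ℝ) / l m)
        (hyperfilter ℕ : Filter ℕ) (𝓝 (1 / 12 - 0)) := by
      refine Tendsto.mono_left ?_ hle
      exact tendsto_const_nhds.sub
        (tendsto_const_nhds.div_atTop (tendsto_natCast_atTop_atTop.comp hlt))
    rw [sub_zero] at h0
    exact le_of_tendsto_of_tendsto' h0 (hμt _) hb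
  obtain ⟨f, hf1, hf2⟩ := exists_seq_list
    (fun L : List ℕ => Good μ (hyperfilter ℕ) S {x | ∀ n ∈ L, x ∈ S n}) (fun i j => i < j)
    (by
      refine ⟨1 / 12, by norm_num, Eventually.of_forall fun d => ?_⟩
      simpa using hSμ d)
    (by
      intro L hL
      have h1 := hL.step hμ
      obtain ⟨n, hn1, hn2⟩ := (h1.and (hyper_ev (P := fun n => L.sum < n) (L.sum + 1)
        (fun n hn => by omega))).exists
      refine ⟨n, ?_, fun x hx => lt_of_le_of_lt (List.le_sum_of_mem hx) hn2⟩
      have e : {x | ∀ k ∈ n :: L, x ∈ S k} = {x | ∀ k ∈ L, x ∈ S k} ∩ S n := by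
        ext x
        simp [and_comm]
      rw [e]
      exact hn1)
  have hc : ∀ n, ∃ c, n ≤ c ∧ ∀ i < n, c ∈ S (f i) := by
    intro n
    obtain ⟨L, hL, hL'⟩ := hf1 n
    obtain ⟨c, hc1, hc2⟩ := hμ.exists_ge (hL.pos hμ) n
    exact ⟨c, hc2, fun i hi => hc1 _ (hL' i hi)⟩
  choose c hcn hcS using hc
  have hfm : StrictMono f := fun i j hij => hf2 i j hij
  obtain ⟨ν, hν, hνt⟩ := exists_mean (a ∘ f) (l ∘ f) (fun n => hl _) (hlt.comp hfm.tendsto_atTop)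
  set p : Ultrafilter ℕ := (hyperfilter ℕ).map c with hp
  have hpS : ∀ i, ∀ᶠ x in (p : Filter ℕ), x ∈ S (f i) := fun i =>
    hyper_ev (P := fun n => c n ∈ S (f i)) (i + 1) fun n hn => hcS n i (by omega)
  refine ⟨p, ν, hν, ?_, fun c => ?_, ?_⟩
  · have : Tendsto c (hyperfilter ℕ : Filter ℕ) atTop :=
      (tendsto_atTop_mono hcn tendsto_id).mono_left hle
    exact this
  · have h0 : Tendsto (fun m => 2 / 3 - (c : ℝ) / (l (f m)))
        (hyperfilter ℕ : Filter ℕ) (𝓝 (2 / 3 - 0)) := by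
      refine Tendsto.mono_left ?_ hle
      exact tendsto_const_nhds.sub
        (tendsto_const_nhds.div_atTop
          (tendsto_natCast_atTop_atTop.comp (hlt.comp hfm.tendsto_atTop)))
    rw [sub_zero] at h0
    refine le_of_tendsto_of_tendsto' h0 (hνt _) fun m => ?_
    simp only [Function.comp]
    rw [le_div_iff₀ (hlr _), sub_mul, div_mul_cancel₀ _ (hlr _).ne', cnt_trans]
    have h1 := cnt_shift A (a (f m)) (l (f m)) c
    have h2 := hd (f m)
    linarith
  · refine ge_of_tendsto' (hνt _) fun i => ?_
    simp only [Function.comp]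
    rw [le_div_iff₀ (hlr _)]
    set L : Set ℕ := {b | ∀ᶠ c in (p : Filter ℕ), b + c ∈ A} with hL
    have h1 : ∀ b, ∀ᶠ x in (p : Filter ℕ), (b ∈ L ↔ b + x ∈ A) := by
      intro b
      by_cases hb : b ∈ L
      · exact Eventually.mono hb fun x hx => by simp [hb, hx]
      · have hb' : ¬ ∀ᶠ c in (p : Filter ℕ), b + c ∈ A := hb
        rw [← Ultrafilter.eventually_not] at hb'
        exact hb'.mono fun x hx => by simp [hb, hx]
    have h2 : ∀ᶠ x in (p : Filter ℕ), ∀ j ∈ Finset.range (l (f i)),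
        (a (f i) + j ∈ L ↔ a (f i) + j + x ∈ A) :=
      (Finset.eventually_all _).2 fun j _ => h1 _
    obtain ⟨x, hx1, hx2⟩ := (h2.and (hpS i)).exists
    have e : cnt L (a (f i)) (l (f i)) = cnt A (a (f i) + x) (l (f i)) := by
      rw [← cnt_trans]
      unfold cnt
      refine Finset.sum_congr rfl fun j hj => ?_
      have := hx1 j hj
      by_cases h : a (f i) + j ∈ L
      · have h' := this.1 h
        simp [h, h']
      · have h' := mt this.2 h
        simp [h, h']
    rw [e]
    exact hx2

lemma second_half (A : Set ℕ) (N : ℕ) (hA : Dense (fat A N) (2 / 3)) :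
    ∃ (f g : ℕ) (q : ℕ → ℕ × ℕ), (∀ i, f ≤ (q i).1 ∧ ∃ a ∈ A, (q i).1 + (q i).2 = a + g) ∧
      ∀ i j, i < j → (q i).1 < (q j).1 ∧ (q i).2 < (q j).2 ∧
        (∃ a ∈ A, (q i).1 + (q j).2 = a + f) ∧ (∃ a ∈ A, (q j).1 + (q i).2 = a + g) := by
  obtain ⟨p, ν, hν, hp, h23, h712⟩ := first_half _ hA
  set L : Set ℕ := {b | ∀ᶠ c in (p : Filter ℕ), b + c ∈ fat A N} with hL
  set T : ℕ → ℕ → Set ℕ := fun g c => {b | ∃ a ∈ A, b + c = a + g} with hT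
  set LL : ℕ → Set ℕ := fun f => {b | ∀ᶠ c in (p : Filter ℕ), ∃ a ∈ A, b + c = a + f} with hLL
  have hLsub : ∀ b ∈ L, ∃ f < N, b ∈ LL f := by
    intro b hb
    by_contra hcon
    push Not at hcon
    have h1 : ∀ᶠ c in (p : Filter ℕ), ∀ f ∈ Finset.range N, ¬ ∃ a ∈ A, b + c = a + f := by
      refine (Finset.eventually_all _).2 fun f hf => ?_
      exact Ultrafilter.eventually_not.2 (hcon f (Finset.mem_range.1 hf))
    obtain ⟨c, hc1, hc2⟩ := (h1.and hb).exists
    obtain ⟨f, hf, hx⟩ := hc2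
    exact hc1 f (Finset.mem_range.2 hf) hx
  have h14 : ∀ c, 1 / 4 ≤ ν (L ∩ {x | x + c ∈ fat A N}) := by
    intro c
    have h1 := hν.union L {x | x + c ∈ fat A N}
    have h2 := hν.le_one (L ∪ {x | x + c ∈ fat A N})
    have h3 := h23 c
    linarith
  set η : ℝ := 1 / (4 * ((N : ℝ) * N + 1)) with hη
  have hηpos : 0 < η := by positivity
  have hηN : (N : ℝ) * N * η < 1 / 4 := by
    rw [hη, mul_one_div, div_lt_div_iff₀ (by positivity) (by norm_num)]
    nlinarith
  obtain ⟨f, g, hfg⟩ : ∃ f g, ∀ᶠ c in (p : Filter ℕ), η ≤ ν (LL f ∩ T g c) := by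
    by_contra hcon
    push Not at hcon
    have h1 : ∀ᶠ c in (p : Filter ℕ), ∀ z ∈ Finset.range N ×ˢ Finset.range N,
        ¬ η ≤ ν (LL z.1 ∩ T z.2 c) := by
      refine (Finset.eventually_all _).2 fun z _ => ?_
      exact (hcon z.1 z.2).mono fun c hc => not_le.2 hc
    obtain ⟨c, hc⟩ := h1.exists
    have h2 : L ∩ {x | x + c ∈ fat A N}
        ⊆ ⋃ z ∈ Finset.range N ×ˢ Finset.range N, (LL z.1 ∩ T z.2 c) := by
      rintro b ⟨hb1, g, hg, hb2⟩
      obtain ⟨f, hf, hb3⟩ := hLsub b hb1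
      simp only [Set.mem_iUnion]
      exact ⟨(f, g), by simp [hf, hg], hb3, hb2⟩
    have h3 := hν.mono h2
    have h4 := hν.biUnion (Finset.range N ×ˢ Finset.range N) (fun z => LL z.1 ∩ T z.2 c)
    have h5 : ∑ z ∈ Finset.range N ×ˢ Finset.range N, ν (LL z.1 ∩ T z.2 c)
        ≤ ∑ z ∈ Finset.range N ×ˢ Finset.range N, η :=
      Finset.sum_le_sum fun z hz => (not_le.1 (hc z hz)).le
    have h6 : ∑ z ∈ Finset.range N ×ˢ Finset.range N, η = (N : ℝ) * N * η := by simp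
    have h7 := h14 c
    linarith
  obtain ⟨q, hq1, hq2⟩ := exists_seq_list
    (fun l : List (ℕ × ℕ) =>
      Good ν p (T g) (LL f ∩ {x | ∀ z ∈ l, x ∈ T g z.2}) ∧
        ∀ z ∈ l, z.1 ∈ LL f ∧ f ≤ z.1 ∧ z.1 ∈ T g z.2)
    (fun z w => z.1 < w.1 ∧ z.2 < w.2 ∧ (∃ a ∈ A, z.1 + w.2 = a + f) ∧ w.1 ∈ T g z.2)
    (by
      refine ⟨⟨η, hηpos, ?_⟩, by simp⟩
      simpa using hfg)
    (by
      rintro l ⟨hl1, hl2⟩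
      have h1 := hl1.step hν
      have h2 : ∀ᶠ c in (p : Filter ℕ), (l.map Prod.snd).sum < c := hp (eventually_gt_atTop _)
      have h3 : ∀ᶠ c in (p : Filter ℕ), ∀ z ∈ l.toFinset, ∃ a ∈ A, z.1 + c = a + f :=
        (Finset.eventually_all _).2 fun z hz => (hl2 z (List.mem_toFinset.1 hz)).1
      obtain ⟨c, hc1, hc2, hc3⟩ := (h1.and (h2.and h3)).exists
      obtain ⟨b, ⟨⟨hb1, hb2⟩, hb3⟩, hb4⟩ :=
        hν.exists_ge (hc1.pos hν) (f + (l.map Prod.fst).sum + 1)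
      refine ⟨(b, c), ⟨?_, ?_⟩, ?_⟩
      · have e : LL f ∩ {x | ∀ z ∈ (b, c) :: l, x ∈ T g z.2}
            = LL f ∩ {x | ∀ z ∈ l, x ∈ T g z.2} ∩ T g c := by
          ext x
          simp only [List.mem_cons, Set.mem_inter_iff, Set.mem_ofPred_eq, forall_eq_or_imp]
          tauto
        rw [e]
        exact hc1
      · intro z hz
        rcases List.mem_cons.1 hz with rfl | hz
        · exact ⟨hb1, by simp only; omega, hb3⟩
        · exact hl2 z hz
      · intro z hz
        have i1 : z.1 ≤ (l.map Prod.fst).sum := List.le_sum_of_mem (List.mem_map_of_mem hz)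
        have i2 : z.2 ≤ (l.map Prod.snd).sum := List.le_sum_of_mem (List.mem_map_of_mem hz)
        exact ⟨by simp only; omega, by simp only; omega,
          hc3 z (List.mem_toFinset.2 hz), hb2 z hz⟩)
  refine ⟨f, g, q, fun i => ?_, fun i j hij => hq2 i j hij⟩
  obtain ⟨l, hl, hl'⟩ := hq1 (i + 1)
  exact (hl.2 _ (hl' i (by omega))).2

end

end OneShift

theorem one_shift_integers (A : Set ℕ) (hA : 0 < banachDensity A) :
    ∃ B C : Set ℕ, ∃ k : ℤ, B.Infinite ∧ C.Infinite ∧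
      ∀ b ∈ B, ∀ c ∈ C,
        ((b : ℤ) + (c : ℤ) ∈ (fun a : ℕ => (a : ℤ)) '' A ∪ (fun a : ℕ => (a : ℤ) + k) '' A) := by
  obtain ⟨δ, h0, hδ⟩ := OneShift.dense_of_bd A hA
  obtain ⟨N, hN⟩ := OneShift.hindman A δ h0 hδ
  obtain ⟨f, g, q, hq1, hq2⟩ := OneShift.second_half A N hN
  refine ⟨Set.range fun i => (q i).1 - f, Set.range fun i => (q i).2, (g : ℤ) - f, ?_, ?_, ?_⟩
  · refine Set.infinite_range_of_injective (StrictMono.injective fun i j hij => ?_)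
    have h1 := (hq2 i j hij).1
    have h2 := (hq1 i).1
    have h3 := (hq1 j).1
    omega
  · exact Set.infinite_range_of_injective (StrictMono.injective fun i j hij => (hq2 i j hij).2.1)
  · rintro _ ⟨i, rfl⟩ _ ⟨j, rfl⟩
    have hi := (hq1 i).1
    rcases lt_trichotomy i j with hij | rfl | hij
    · obtain ⟨a, ha, e⟩ := (hq2 i j hij).2.2.1
      exact Or.inl ⟨a, ha, by simp only; omega⟩
    · obtain ⟨a, ha, e⟩ := (hq1 i).2
      exact Or.inr ⟨a, ha, by simp only; omega⟩
    · obtain ⟨a, ha, e⟩ := (hq2 j i hij).2.2.2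
      exact Or.inr ⟨a, ha, by simp only; omega⟩
end
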